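/- arXiv:2405.17847 — 2 statements merged into one kernel-verified Lean document; each statement's English description precedes it below -/
import Mathlib

section
/- Let k ≥ 2 and n ≥ 1, and let T be chosen uniformly at random from the (finite, nonempty) set of k-regular trees with exactly n interior nodes. Then E[IPL(T)] = √(π k n³/(2(k−1))) · (1 + O(n^{−1/2})); that is, there exists a constant M > 0 (depending only on k) such that for all n ≥ 1, | E[IPL(T)] / √(π k n³/(2(k−1))) − 1 | ≤ M·n^{−1/2}. -/
/-- Ordered full `k`-ary plane trees.  A `k`-regular rooted tree (root `∘` of
degree one, every other interior node with exactly `k` ordered children) with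
`n` interior nodes corresponds exactly to a `KTree k` with `n - 1` internal
nodes, namely the subtree hanging from the single child of `∘`. -/
inductive KTree (k : ℕ) : Type where
  | leaf : KTree k
  | node : (Fin k → KTree k) → KTree k

namespace KTree

variable {k : ℕ}

/-- The number of internal nodes. -/
def numNodes : KTree k → ℕ
  | leaf => 0
  | node f => 1 + ∑ i, numNodes (f i)

/-- The sum of the depths of the internal nodes (depth measured within the
plane tree, its root having depth `0`). -/
def ipl : KTree k → ℕ
  | leaf => 0
  | node f => ∑ i, (ipl (f i) + numNodes (f i))

/-- In the `k`-regular rooted tree corresponding to `t` (whose interior nodes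
are the root `∘`, at depth `0`, together with the internal nodes of `t`, an
internal node of `t` at depth `d` having depth `d + 1`), the internal path
length is `ipl t + numNodes t`. -/
def iplReg (t : KTree k) : ℕ := t.ipl + t.numNodes

end KTree

/-- The set of `k`-regular trees with exactly `n` interior nodes, encoded as
plane trees. -/
def kRegSet (k n : ℕ) : Set (KTree k) := {t | t.numNodes = n - 1}

open KTree in
/-- The expected internal path length of a uniformly random `k`-regular tree
with `n` interior nodes. -/
noncomputable def expIPL (k n : ℕ) : ℝ :=
  (∑ᶠ t ∈ kRegSet k n, (iplReg t : ℝ)) / (Nat.card (kRegSet k n) : ℝ)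

open KTree in
/-- The variance of the internal path length of a uniformly random
`k`-regular tree with `n` interior nodes. -/
noncomputable def varIPL (k n : ℕ) : ℝ :=
  (∑ᶠ t ∈ kRegSet k n, ((iplReg t : ℝ) - expIPL k n) ^ 2) /
    (Nat.card (kRegSet k n) : ℝ)

open PowerSeries in
theorem KTree.finite_le (k m : ℕ) : {t : KTree k | t.numNodes ≤ m}.Finite := by
  induction m with
  | zero =>
    refine (Set.finite_singleton (KTree.leaf : KTree k)).subset ?_
    rintro (_ | f) h
    · simp
    · simp [KTree.numNodes] at h
  | succ m ih =>
    have h1 : (Set.pi Set.univ (fun _ : Fin k => {t : KTree k | t.numNodes ≤ m})).Finite :=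
      Set.Finite.pi' (fun _ => ih) |>.subset (by intro f hf i; exact hf i trivial)
    refine ((h1.image KTree.node).union (Set.finite_singleton (KTree.leaf : KTree k))).subset ?_
    rintro (_ | f) h
    · simp
    · left
      refine ⟨f, ?_, rfl⟩
      intro i _
      simp only [KTree.numNodes, Set.mem_ofPred_eq] at h ⊢
      have := Finset.single_le_sum (f := fun i => (f i).numNodes) (fun _ _ => Nat.zero_le _)
        (Finset.mem_univ i)
      omega

theorem KTree.finite_eq (k m : ℕ) : {t : KTree k | t.numNodes = m}.Finite :=
  (KTree.finite_le k m).subset (fun _ h => le_of_eq h)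

theorem KTree.finite_forest (k m : ℕ) :
    {f : Fin k → KTree k | ∑ i, (f i).numNodes = m}.Finite := by
  refine (Set.Finite.pi' (fun _ : Fin k => KTree.finite_le k m)).subset ?_
  intro f h i
  have := Finset.single_le_sum (f := fun i => (f i).numNodes) (fun _ _ => Nat.zero_le _)
        (Finset.mem_univ i)
  simp only [Set.mem_ofPred_eq] at h this ⊢
  omega

/-- The finset of trees of size `m`. -/
noncomputable def treesOf (k m : ℕ) : Finset (KTree k) := (KTree.finite_eq k m).toFinset

/-- The finset of `k`-forests of size `m`. -/
noncomputable def forestsOf (k m : ℕ) : Finset (Fin k → KTree k) :=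
  (KTree.finite_forest k m).toFinset

@[simp] theorem mem_treesOf {k m : ℕ} {t : KTree k} : t ∈ treesOf k m ↔ t.numNodes = m := by
  simp [treesOf]

@[simp] theorem mem_forestsOf {k m : ℕ} {f : Fin k → KTree k} :
    f ∈ forestsOf k m ↔ ∑ i, (f i).numNodes = m := by
  simp [forestsOf]

/-- Weighted generating series of trees. -/
noncomputable def gs (k : ℕ) (w : KTree k → ℝ) : PowerSeries ℝ :=
  PowerSeries.mk fun m => ∑ t ∈ treesOf k m, w t

theorem treesOf_zero (k : ℕ) : treesOf k 0 = {KTree.leaf} := by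
  ext t
  rcases t with _ | f <;> simp [KTree.numNodes]

theorem sum_treesOf_succ (k d : ℕ) (w : KTree k → ℝ) :
    ∑ t ∈ treesOf k (d + 1), w t = ∑ f ∈ forestsOf k d, w (KTree.node f) := by
  symm
  refine Finset.sum_bij (fun f _ => KTree.node f) ?_ ?_ ?_ ?_
  · intro f hf
    simp only [mem_forestsOf, mem_treesOf, KTree.numNodes] at hf ⊢
    omega
  · intro f _ g _ h
    simpa using h
  · rintro (_ | f) h
    · simp [KTree.numNodes] at h
    · simp only [mem_treesOf, KTree.numNodes] at h
      exact ⟨f, by simp only [mem_forestsOf]; omega, rfl⟩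
  · intros; rfl

theorem coeff_prod_gs (k d : ℕ) (w : Fin k → KTree k → ℝ) :
    PowerSeries.coeff d (∏ i, gs k (w i)) = ∑ f ∈ forestsOf k d, ∏ i, w i (f i) := by
  classical
  rw [PowerSeries.coeff_prod]
  rw [← Finset.sum_fiberwise_of_maps_to (s := forestsOf k d)
    (t := Finset.finsuppAntidiag Finset.univ d)
    (g := fun f => Finsupp.equivFunOnFinite.symm (fun i => (f i).numNodes))]
  · refine Finset.sum_congr rfl ?_
    intro l hl
    simp only [gs, PowerSeries.coeff_mk]
    rw [Finset.prod_univ_sum]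
    refine Finset.sum_congr ?_ (fun _ _ => rfl)
    ext f
    simp only [Finset.mem_finsuppAntidiag, Finset.subset_univ, and_true] at hl
    simp only [Fintype.mem_piFinset, mem_treesOf, Finset.mem_filter, mem_forestsOf]
    constructor
    · intro h
      refine ⟨?_, ?_⟩
      · simp only [h]; exact hl
      · ext i; simp [h]
    · rintro ⟨_, h⟩ i
      rw [← h]; simp
  · intro f hf
    simp only [mem_forestsOf] at hf
    simp [Finset.mem_finsuppAntidiag, hf]

/-- Tree counting series. -/
noncomputable def gT (k : ℕ) : PowerSeries ℝ := gs k (fun _ => 1)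
/-- Path length series. -/
noncomputable def gP (k : ℕ) : PowerSeries ℝ := gs k (fun t => (t.iplReg : ℝ))

open PowerSeries in
theorem gT_eq (k : ℕ) : gT k = 1 + X * gT k ^ k := by
  ext d
  rcases d with _ | d
  · simp [gT, gs, treesOf_zero]
  · have h := coeff_prod_gs k d (fun _ _ => 1)
    simp only [Finset.prod_const, Finset.card_univ, Fintype.card_fin] at h
    rw [map_add, coeff_succ_X_mul, gT, h]
    rw [gs, coeff_mk, sum_treesOf_succ]; simp [coeff_one]

open PowerSeries in
theorem gP_eq (k : ℕ) : gP k = X * d⁄dX ℝ (gT k) + (k : PowerSeries ℝ) * X * gT k ^ (k - 1) * gP k := by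
  classical
  ext d
  rcases d with _ | d
  · rw [mul_assoc (k : PowerSeries ℝ), mul_assoc (k : PowerSeries ℝ), mul_assoc X]
    simp [gP, gs, treesOf_zero, KTree.iplReg, KTree.ipl, KTree.numNodes]
  · have e1 (j : Fin k) : ∏ i, gs k ((Function.update (fun _ _ => 1) j
        (fun t => (t.iplReg : ℝ)) : Fin k → KTree k → ℝ) i) = gT k ^ (k - 1) * gP k := by
      rw [← Finset.prod_erase_mul _ _ (Finset.mem_univ j)]
      congr 1
      · rw [Finset.prod_congr rfl (g := fun _ => gT k)]
        · simp
        · intro i hi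
          simp only [Finset.mem_erase] at hi
          simp [hi.1, gT]
      · simp [gP]
    have e2 (j : Fin k) (f : Fin k → KTree k) : ∏ i, ((Function.update (fun _ _ => 1) j
        (fun t => (t.iplReg : ℝ)) : Fin k → KTree k → ℝ) i) (f i) = ((f j).iplReg : ℝ) := by
      rw [← Finset.prod_erase_mul _ _ (Finset.mem_univ j)]
      rw [Finset.prod_eq_one]
      · simp
      · intro i hi
        simp only [Finset.mem_erase] at hi
        simp [hi.1]
    have h (j : Fin k) : coeff d (gT k ^ (k - 1) * gP k)
        = ∑ f ∈ forestsOf k d, ((f j).iplReg : ℝ) := by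
      rw [← e1 j, coeff_prod_gs]
      exact Finset.sum_congr rfl (fun f _ => e2 j f)
    have e3 : (k : PowerSeries ℝ) * X * gT k ^ (k - 1) * gP k
        = X * ∑ j : Fin k, (gT k ^ (k - 1) * gP k) := by
      simp; ring
    rw [e3, map_add, coeff_succ_X_mul, coeff_succ_X_mul, map_sum]
    rw [Finset.sum_congr rfl (fun j _ => h j)]
    rw [Finset.sum_comm, coeff_derivative, gP, gs, coeff_mk, sum_treesOf_succ, gT, gs, coeff_mk,
      sum_treesOf_succ, Finset.sum_mul, ← Finset.sum_add_distrib]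
    refine Finset.sum_congr rfl ?_
    intro f hf
    simp only [mem_forestsOf] at hf
    have : (KTree.node f).iplReg = (d + 1) + ∑ j, (f j).iplReg := by
      simp only [KTree.iplReg, KTree.ipl, KTree.numNodes, hf]; ring
    rw [this]; push_cast; ring

open PowerSeries in
theorem coeff_gT_pow (k : ℕ) (hk : 1 ≤ k) (m : ℕ) : ∀ r : ℕ,
    ((k * m + r : ℕ) : ℝ) * coeff m (gT k ^ r) = r * ((k * m + r).choose m : ℝ) := by
  have hrec (r : ℕ) : gT k ^ (r + 1) = gT k ^ r + X * gT k ^ (r + k) := by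
    conv_lhs => rw [pow_succ]; rhs; rw [gT_eq]
    rw [pow_add]; ring
  induction m with
  | zero =>
    intro r
    have : constantCoeff (gT k) = 1 := by
      rw [gT_eq]; simp
    simp [this]
  | succ m ih =>
    intro r
    induction r with
    | zero => simp [coeff_one]
    | succ r ihr =>
      have h := ih (r + k)
      rw [hrec, map_add, coeff_succ_X_mul]
      obtain ⟨N, hN⟩ : ∃ N, N = k * (m + 1) + r := ⟨_, rfl⟩
      have e1 : k * m + (r + k) = N := by rw [hN]; ring
      have e2 : k * (m + 1) + (r + 1) = N + 1 := by rw [hN]; ring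
      rw [e1] at h
      rw [← hN] at ihr
      rw [e2]
      have hNm : m + 1 ≤ N := by rw [hN]; nlinarith
      have hc := Nat.choose_succ_right_eq N m
      have hp := Nat.choose_succ_succ' N m
      have hc' : (N.choose (m + 1) : ℝ) * (m + 1) = N.choose m * (N - m) := by
        have : ((N - m : ℕ) : ℝ) = (N : ℝ) - m := by push_cast [Nat.cast_sub (by omega : m ≤ N)]; ring
        rw [← this]; exact_mod_cast hc
      rw [hp]
      have hNr : (N : ℝ) = k * (m + 1) + r := by rw [hN]; push_cast; ring
      have hN0 : (N : ℝ) ≠ 0 := by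
        have : 0 < N := by omega
        positivity
      apply mul_left_cancel₀ hN0
      push_cast at h ihr ⊢
      have : (N : ℝ) * ((N + 1) * (coeff (m + 1) (gT k ^ r) + coeff m (gT k ^ (r + k))))
        = (N + 1) * (r * N.choose (m + 1) + (r + k) * N.choose m) := by
        rw [← ihr, ← h]; ring
      rw [this]
      generalize (N.choose (m + 1) : ℝ) = a at *
      generalize (N.choose m : ℝ) = b at *
      rw [hNr] at hc' ⊢
      linear_combination (-(k:ℝ)) * hc'

open PowerSeries in
/-- `F`-series. -/
noncomputable def gF (k : ℕ) : PowerSeries ℝ := mk fun m => ((k * m).choose m : ℝ)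

open PowerSeries in
theorem coeff_gT (k : ℕ) (hk : 1 ≤ k) (m : ℕ) :
    (((k : ℝ) - 1) * m + 1) * coeff m (gT k) = ((k * m).choose m : ℝ) := by
  have h := coeff_gT_pow k hk m 1
  rw [pow_one] at h
  have h2 := Nat.choose_mul_succ_eq (k * m) m
  have hm : m ≤ k * m := by nlinarith
  have h3 : ((k * m).choose m : ℝ) * (k * m + 1) = (k * m + 1).choose m * (k * m + 1 - m) := by
    have : ((k * m + 1 - m : ℕ) : ℝ) = (k : ℝ) * m + 1 - m := by
      push_cast [Nat.cast_sub (by omega : m ≤ k * m + 1)]; ring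
    rw [← this]; exact_mod_cast h2
  push_cast at h
  have h0 : (k : ℝ) * m + 1 ≠ 0 := by positivity
  apply mul_left_cancel₀ h0
  linear_combination (k * m + 1 - m : ℝ) * h - h3

open PowerSeries in
theorem gF_mul (k : ℕ) (hk : 1 ≤ k) :
    gF k * (1 - (k : PowerSeries ℝ) * X * gT k ^ (k - 1)) = 1 := by
  have h1 : gF k = gT k + ((k : PowerSeries ℝ) - 1) * X * d⁄dX ℝ (gT k) := by
    have e : ((k : PowerSeries ℝ) - 1) * X * d⁄dX ℝ (gT k)
      = C ((k : ℝ) - 1) * (X * d⁄dX ℝ (gT k)) := by simp; ring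
    rw [e]
    ext m
    rw [map_add, coeff_C_mul, gF, coeff_mk, ← coeff_gT k hk m]
    rcases m with _ | m
    · simp
    · rw [coeff_succ_X_mul, coeff_derivative]; push_cast; ring
  have h2 : d⁄dX ℝ (gT k) = gT k ^ k + (k : PowerSeries ℝ) * X * gT k ^ (k - 1) * d⁄dX ℝ (gT k) := by
    conv_lhs => rw [gT_eq]
    simp [Derivation.leibniz, Derivation.leibniz_pow]
    ring
  have h3 := gT_eq k
  have h4 : gT k ^ k = gT k ^ (k - 1) * gT k := by
    rw [← pow_succ]; congr 1; omega
  rw [h1]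
  rw [h4] at h2 h3
  linear_combination ((k : PowerSeries ℝ) - 1) * X * h2 + h3

open PowerSeries in
theorem gP_eq_mul (k : ℕ) (hk : 1 ≤ k) : gP k = X * d⁄dX ℝ (gT k) * gF k := by
  linear_combination (gF k) * gP_eq k - gP k * gF_mul k hk

open PowerSeries in
theorem coeff_gP (k : ℕ) (hk : 1 ≤ k) (m : ℕ) :
    coeff m (gP k) = ∑ p ∈ Finset.HasAntidiagonal.antidiagonal m,
      (p.1 * coeff p.1 (gT k)) * ((k * p.2).choose p.2 : ℝ) := by
  rw [gP_eq_mul k hk, coeff_mul]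
  refine Finset.sum_congr rfl ?_
  rintro ⟨i, j⟩ _
  simp only [gF, coeff_mk]
  congr 1
  rcases i with _ | i
  · simp
  · rw [coeff_succ_X_mul, coeff_derivative]; push_cast; ring

open PowerSeries in
theorem sum_central (m : ℕ) :
    ∑ p ∈ Finset.HasAntidiagonal.antidiagonal m, ((2 * p.1).choose p.1 : ℝ) * ((2 * p.2).choose p.2 : ℝ) = 4 ^ m := by
  have h := gF_mul 2 (by norm_num)
  have hT := gT_eq 2
  have h1 : gF 2 * gF 2 * (1 - 4 * X) = 1 := by
    simp only [Nat.add_one_sub_one, pow_one] at h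
    push_cast at h
    have e : (1 - 4 * X : PowerSeries ℝ) = (1 - 2 * X * gT 2) ^ 2 := by
      linear_combination (4 * X) * hT
    rw [e]
    linear_combination (gF 2 * (1 - 2 * X * gT 2) + 1) * h
  have h2 : ∀ m, coeff m (gF 2 * gF 2) = 4 ^ m := by
    have h3 : gF 2 * gF 2 = 1 + C 4 * (X * (gF 2 * gF 2)) := by
      have : (C 4 : PowerSeries ℝ) = 4 := map_ofNat C 4
      rw [this]
      linear_combination h1
    intro m
    induction m with
    | zero => simp [gF]
    | succ m ih =>
      rw [h3, map_add, coeff_C_mul, coeff_succ_X_mul, ih]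
      simp [coeff_one]; ring
  rw [← h2 m, coeff_mul]
  simp [gF]

theorem expIPL_eq (k n : ℕ) : expIPL k n =
    PowerSeries.coeff (n - 1) (gP k) / PowerSeries.coeff (n - 1) (gT k) := by
  have hs : kRegSet k n = ↑(treesOf k (n - 1)) := by
    ext t; simp [kRegSet]
  rw [expIPL, hs, finsum_mem_coe_finset, gP, gT, gs, gs, PowerSeries.coeff_mk, PowerSeries.coeff_mk,
    Nat.card_coe_set_eq, Set.ncard_coe_finset]
  simp

open Filter Topology Asymptotics

/-- Basic comparison sequence `1/√(j+1)`. -/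
noncomputable def xs (j : ℕ) : ℝ := 1 / √((j : ℝ) + 1)

theorem xs_pos (j : ℕ) : 0 < xs j := by unfold xs; positivity

theorem xs_sq (j : ℕ) : xs j ^ 2 = 1 / ((j : ℝ) + 1) := by
  unfold xs; rw [div_pow, Real.sq_sqrt (by positivity)]; simp

theorem xs_le_one (j : ℕ) : xs j ≤ 1 := by
  unfold xs
  rw [div_le_one (by positivity)]
  exact Real.one_le_sqrt.mpr (by linarith [Nat.cast_nonneg (α := ℝ) j])

theorem xs_tendsto : Tendsto xs atTop (𝓝 0) := by
  have h : Tendsto (fun j : ℕ => √(1 / ((j : ℝ) + 1))) atTop (𝓝 √0) :=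
    (Real.continuous_sqrt.tendsto 0).comp tendsto_one_div_add_atTop_nhds_zero_nat
  rw [Real.sqrt_zero] at h
  refine h.congr (fun j => ?_)
  unfold xs; rw [Real.sqrt_div zero_le_one, Real.sqrt_one]

theorem inv_isBigO : (fun j : ℕ => 1 / (j : ℝ)) =O[atTop] (fun j => xs j ^ 2) := by
  refine IsBigO.of_bound 2 ?_
  filter_upwards [eventually_ge_atTop 1] with j hj
  have hj' : (1 : ℝ) ≤ j := by exact_mod_cast hj
  rw [xs_sq, Real.norm_of_nonneg (by positivity), Real.norm_of_nonneg (by positivity),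
    mul_one_div, div_le_div_iff₀ (by positivity) (by positivity)]
  linarith

theorem xs_sq_isBigO : (fun j => xs j ^ 2) =O[atTop] xs := by
  refine IsBigO.of_bound 1 (Eventually.of_forall fun j => ?_)
  have := xs_pos j
  rw [Real.norm_of_nonneg (by positivity), Real.norm_of_nonneg (by positivity)]
  nlinarith [xs_le_one j]

theorem xs_cube_isBigO : (fun j => xs j ^ 3) =O[atTop] xs := by
  refine IsBigO.of_bound 1 (Eventually.of_forall fun j => ?_)
  have := xs_pos j
  rw [Real.norm_of_nonneg (by positivity), Real.norm_of_nonneg (by positivity)]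
  have := pow_le_of_le_one (xs_pos j).le (xs_le_one j) (n := 3) (by norm_num)
  linarith

theorem xs_cube_summable : Summable (fun j => xs j ^ 3) := by
  have h : Summable (fun n : ℕ => 1 / ((n : ℝ)) ^ (3 / 2 : ℝ)) :=
    Real.summable_one_div_nat_rpow.mpr (by norm_num)
  have h2 := (summable_nat_add_iff 1).mpr h
  refine h2.congr (fun j => ?_)
  unfold xs
  rw [div_pow, one_pow, Real.sqrt_eq_rpow, ← Real.rpow_natCast, ← Real.rpow_mul (by positivity)]
  push_cast
  norm_num

theorem xs_term (m i j : ℕ) (h : i + j = m) :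
    xs i ^ 3 * xs j ≤ xs m * (2 * xs i ^ 3 + xs j ^ 3) := by
  have hi := xs_pos i
  have hj := xs_pos j
  have hm := xs_pos m
  have h1 : 1 / xs m ≤ 1 / xs i + 1 / xs j := by
    unfold xs
    simp only [one_div_one_div]
    apply Real.sqrt_le_left (by positivity) |>.mpr
    have e1 := Real.sq_sqrt (show (0 : ℝ) ≤ i + 1 by positivity)
    have e2 := Real.sq_sqrt (show (0 : ℝ) ≤ j + 1 by positivity)
    have e3 : 0 ≤ √((i : ℝ) + 1) * √((j : ℝ) + 1) := by positivity
    have : (m : ℝ) = i + j := by exact_mod_cast h.symm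
    rw [this]
    nlinarith
  have h2 : xs i ^ 3 * xs j * (1 / xs m) ≤ 2 * xs i ^ 3 + xs j ^ 3 := by
    calc xs i ^ 3 * xs j * (1 / xs m) ≤ xs i ^ 3 * xs j * (1 / xs i + 1 / xs j) := by gcongr
      _ = xs i ^ 2 * xs j + xs i ^ 3 := by field_simp
      _ ≤ _ := by
        rcases le_total (xs i) (xs j) with hh | hh
        · have : xs i ^ 2 ≤ xs j ^ 2 := by gcongr
          nlinarith [pow_pos hi 3]
        · have : xs i ^ 2 * xs j ≤ xs i ^ 2 * xs i := by gcongr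
          nlinarith [pow_pos hj 3]
  calc xs i ^ 3 * xs j = xs m * (xs i ^ 3 * xs j * (1 / xs m)) := by field_simp
    _ ≤ _ := by gcongr

theorem xs_conv : ∃ B : ℝ, 0 < B ∧ ∀ m : ℕ,
    ∑ p ∈ Finset.HasAntidiagonal.antidiagonal m, xs p.1 ^ 3 * xs p.2 ≤ B * xs m := by
  have hnn : ∀ j, 0 ≤ xs j ^ 3 := fun j => (pow_pos (xs_pos j) 3).le
  have hS : 0 ≤ ∑' j, xs j ^ 3 := tsum_nonneg hnn
  refine ⟨3 * (∑' j, xs j ^ 3) + 1, by positivity, fun m => ?_⟩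
  have hb : ∀ s : Finset ℕ, ∑ j ∈ s, xs j ^ 3 ≤ ∑' j, xs j ^ 3 := fun s =>
    xs_cube_summable.sum_le_tsum s (fun j _ => hnn j)
  have h1 : ∑ p ∈ Finset.HasAntidiagonal.antidiagonal m, xs p.1 ^ 3
      = ∑ j ∈ Finset.range (m + 1), xs j ^ 3 :=
    Finset.Nat.sum_antidiagonal_eq_sum_range_succ (fun i _ => xs i ^ 3) m
  have h2 : ∑ p ∈ Finset.HasAntidiagonal.antidiagonal m, xs p.2 ^ 3
      = ∑ p ∈ Finset.HasAntidiagonal.antidiagonal m, xs p.1 ^ 3 :=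
    Finset.Nat.sum_antidiagonal_swap (f := fun p : ℕ × ℕ => xs p.1 ^ 3)
  calc _ ≤ ∑ p ∈ Finset.HasAntidiagonal.antidiagonal m,
        xs m * (2 * xs p.1 ^ 3 + xs p.2 ^ 3) := by
        refine Finset.sum_le_sum (fun p hp => xs_term m p.1 p.2 ?_)
        simpa using hp
    _ = xs m * (3 * ∑ j ∈ Finset.range (m + 1), xs j ^ 3) := by
        rw [← Finset.mul_sum, Finset.sum_add_distrib, ← Finset.mul_sum, h2, h1]; ring
    _ ≤ xs m * (3 * (∑' j, xs j ^ 3) + 1) := by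
        have := xs_pos m
        have := hb (Finset.range (m + 1))
        gcongr
        linarith
    _ = _ := by ring

theorem bound_all {f : ℕ → ℝ} {r : ℕ} (h : f =O[atTop] (fun j => xs j ^ r)) :
    ∃ K : ℝ, 0 < K ∧ ∀ j, |f j| ≤ K * xs j ^ r := by
  obtain ⟨C, hC, hb⟩ := bound_of_isBigO_nat_atTop h
  refine ⟨C, hC, fun j => ?_⟩
  have := hb (x := j) (pow_pos (xs_pos j) r).ne'
  rwa [Real.norm_eq_abs, Real.norm_of_nonneg (pow_pos (xs_pos j) r).le] at this

theorem conv_isBigO {f f' g g' : ℕ → ℝ}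
    (hf : (fun j => f j - f' j) =O[atTop] (fun j => xs j ^ 3))
    (hg : (fun j => g j - g' j) =O[atTop] (fun j => xs j ^ 3))
    (hf' : f' =O[atTop] xs) (hg' : g =O[atTop] xs) :
    (fun m => ∑ p ∈ Finset.HasAntidiagonal.antidiagonal m, f p.1 * g p.2
      - ∑ p ∈ Finset.HasAntidiagonal.antidiagonal m, f' p.1 * g' p.2) =O[atTop] xs := by
  obtain ⟨K1, hK1, h1⟩ := bound_all hf
  obtain ⟨K2, hK2, h2⟩ := bound_all hg
  obtain ⟨K3, hK3, h3⟩ := bound_all (r := 1) (by simpa using hf')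
  obtain ⟨K4, hK4, h4⟩ := bound_all (r := 1) (by simpa using hg')
  simp only [pow_one] at h3 h4
  obtain ⟨B, hB, hc⟩ := xs_conv
  refine IsBigO.of_bound (K1 * K4 * B + K2 * K3 * B) (Eventually.of_forall fun m => ?_)
  rw [Real.norm_eq_abs, Real.norm_of_nonneg (xs_pos m).le, ← Finset.sum_sub_distrib]
  have hsw : ∑ p ∈ Finset.HasAntidiagonal.antidiagonal m, xs p.2 ^ 3 * xs p.1
      = ∑ p ∈ Finset.HasAntidiagonal.antidiagonal m, xs p.1 ^ 3 * xs p.2 :=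
    Finset.Nat.sum_antidiagonal_swap (f := fun p : ℕ × ℕ => xs p.1 ^ 3 * xs p.2)
  calc _ ≤ ∑ p ∈ Finset.HasAntidiagonal.antidiagonal m, |f p.1 * g p.2 - f' p.1 * g' p.2| :=
        Finset.abs_sum_le_sum_abs _ _
    _ ≤ ∑ p ∈ Finset.HasAntidiagonal.antidiagonal m,
        (K1 * K4 * (xs p.1 ^ 3 * xs p.2) + K2 * K3 * (xs p.2 ^ 3 * xs p.1)) := by
        refine Finset.sum_le_sum (fun p _ => ?_)
        have e : f p.1 * g p.2 - f' p.1 * g' p.2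
          = (f p.1 - f' p.1) * g p.2 + f' p.1 * (g p.2 - g' p.2) := by ring
        rw [e]
        refine (abs_add_le _ _).trans ?_
        rw [abs_mul, abs_mul]
        have a1 := mul_le_mul (h1 p.1) (h4 p.2) (abs_nonneg _)
          (mul_pos hK1 (pow_pos (xs_pos _) 3)).le
        have a2 := mul_le_mul (h3 p.1) (h2 p.2) (abs_nonneg _)
          (mul_pos hK3 (xs_pos _)).le
        linarith
    _ = (K1 * K4 + K2 * K3) *
        ∑ p ∈ Finset.HasAntidiagonal.antidiagonal m, xs p.1 ^ 3 * xs p.2 := by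
        rw [Finset.sum_add_distrib, ← Finset.mul_sum, ← Finset.mul_sum, hsw]; ring
    _ ≤ (K1 * K4 + K2 * K3) * (B * xs m) := by
        gcongr; exact hc m
    _ = _ := by ring

theorem stirling_rate :
    (fun n : ℕ => Stirling.stirlingSeq n - √Real.pi) =O[atTop] (fun n : ℕ => 1 / (n : ℝ)) := by
  refine IsBigO.of_bound (√Real.pi * 2) ?_
  filter_upwards [eventually_ge_atTop 1] with n hn
  have hn' : (1 : ℝ) ≤ n := by exact_mod_cast hn
  have hpi : 0 < √Real.pi := Real.sqrt_pos.mpr Real.pi_pos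
  have hle := Stirling.sqrt_pi_le_stirlingSeq (n := n) (by omega)
  have hpos : 0 < Stirling.stirlingSeq n := by linarith
  have key : ∀ p : ℕ, Real.log (Stirling.stirlingSeq n) - Real.log (Stirling.stirlingSeq (p + n))
      ≤ 1 / (12 * n) - 1 / (12 * ((p : ℝ) + n)) := by
    intro p
    induction p with
    | zero => simp
    | succ p ih =>
      have h := Stirling.log_stirlingSeq_sdiff_le (p + n)
      have e : p + 1 + n = p + n + 1 := by ring
      rw [e]
      have e2 : (1 : ℝ) / (12 * ((p + n : ℕ) : ℝ) * (((p + n : ℕ) : ℝ) + 1))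
        = 1 / (12 * ((p : ℝ) + n)) - 1 / (12 * (((p + 1 : ℕ) : ℝ) + n)) := by
        push_cast
        have : (p : ℝ) + n ≠ 0 := by positivity
        have : (p : ℝ) + 1 + n ≠ 0 := by positivity
        have : (p : ℝ) + n + 1 ≠ 0 := by positivity
        field_simp
        ring
      linarith
  have hlim : Tendsto (fun p : ℕ => Real.log (Stirling.stirlingSeq n)
      - Real.log (Stirling.stirlingSeq (p + n))) atTop
      (𝓝 (Real.log (Stirling.stirlingSeq n) - Real.log √Real.pi)) := by
    refine tendsto_const_nhds.sub ?_
    exact (((Real.continuousAt_log hpi.ne').tendsto).comp Stirling.tendsto_stirlingSeq_sqrt_pi).comp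
      (tendsto_add_atTop_nat n)
  have hfin : Real.log (Stirling.stirlingSeq n) - Real.log √Real.pi ≤ 1 / n := by
    refine le_of_tendsto' hlim (fun p => (key p).trans ?_)
    have : 0 ≤ 1 / (12 * ((p : ℝ) + n)) := by positivity
    have : 1 / (12 * (n : ℝ)) ≤ 1 / n := by
      apply one_div_le_one_div_of_le <;> linarith
    linarith
  have h3 : Stirling.stirlingSeq n ≤ √Real.pi * Real.exp (1 / n) := by
    rw [← Real.log_le_log_iff hpos (by positivity), Real.log_mul hpi.ne' (Real.exp_pos _).ne',
      Real.log_exp]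
    linarith
  have h1n : 1 / (n : ℝ) ≤ 1 := by rw [div_le_one (by linarith)]; exact hn'
  have h4 := Real.abs_exp_sub_one_le (x := 1 / (n : ℝ)) (by
    rw [abs_of_nonneg (by positivity)]; exact h1n)
  rw [abs_of_nonneg (a := 1 / (n : ℝ)) (by positivity)] at h4
  have h5 := (abs_le.mp h4).2
  rw [Real.norm_of_nonneg (by linarith), Real.norm_of_nonneg (by positivity)]
  nlinarith

/-- Normalized binomials. -/
noncomputable def aq (q j : ℕ) : ℝ :=
  (((q + 1) * j).choose j : ℝ) * ((q : ℝ) ^ q / ((q : ℝ) + 1) ^ (q + 1)) ^ j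

/-- The constant. -/
noncomputable def Aq (q : ℕ) : ℝ := √(((q : ℝ) + 1) / (2 * q))

theorem fact_eq (n : ℕ) (hn : 1 ≤ n) : (n.factorial : ℝ) =
    Stirling.stirlingSeq n * (√(2 * n) * (n / Real.exp 1) ^ n) := by
  have : (0 : ℝ) < n := by exact_mod_cast hn
  unfold Stirling.stirlingSeq
  field_simp

theorem aq_eq (q j : ℕ) (hq : 1 ≤ q) (hj : 1 ≤ j) : aq q j * √j =
    Stirling.stirlingSeq ((q + 1) * j) / (Stirling.stirlingSeq j * Stirling.stirlingSeq (q * j))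
      * Aq q := by
  have hq' : (0 : ℝ) < q := by exact_mod_cast hq
  have hj' : (0 : ℝ) < j := by exact_mod_cast hj
  have hqj : 1 ≤ q * j := Nat.mul_pos hq hj
  have hk : 1 ≤ (q + 1) * j := Nat.mul_pos (by omega) hj
  have hle : j ≤ (q + 1) * j := by nlinarith
  have hsub : (q + 1) * j - j = q * j := by
    rw [add_mul, one_mul]; omega
  have pos : ∀ n, 1 ≤ n → 0 < Stirling.stirlingSeq n := fun n hn => by
    obtain ⟨m, rfl⟩ := Nat.exists_eq_add_of_le' hn
    exact Stirling.stirlingSeq'_pos m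
  have p1 := pos _ hj
  have p2 := pos _ hqj
  unfold aq
  rw [Nat.cast_choose ℝ hle, hsub, fact_eq _ hk, fact_eq _ hj, fact_eq _ hqj]
  generalize Stirling.stirlingSeq ((q + 1) * j) = s1
  generalize Stirling.stirlingSeq j = s2 at *
  generalize Stirling.stirlingSeq (q * j) = s3 at *
  push_cast
  have hA : Aq q = √(2 * (((q : ℝ) + 1) * j)) / (√(2 * (j : ℝ)) * √(2 * (q * j))) * √j := by
    unfold Aq
    rw [← Real.sqrt_mul (by positivity), ← Real.sqrt_div (by positivity),
      ← Real.sqrt_mul (by positivity)]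
    congr 1
    field_simp
  have hpow : (((q : ℝ) + 1) * j / Real.exp 1) ^ ((q + 1) * j) *
      ((q : ℝ) ^ q / ((q : ℝ) + 1) ^ (q + 1)) ^ j
      = (j / Real.exp 1) ^ j * (q * j / Real.exp 1) ^ (q * j) := by
    rw [mul_div_assoc, mul_div_assoc (q : ℝ)]
    generalize (j : ℝ) / Real.exp 1 = y
    rw [mul_pow, mul_pow, div_pow, ← pow_mul, ← pow_mul]
    have : ((q : ℝ) + 1) ^ ((q + 1) * j) ≠ 0 := by positivity
    field_simp
    ring
  rw [hA]
  have e1 : (0 : ℝ) < (j / Real.exp 1) ^ j := by positivity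
  have e2 : (0 : ℝ) < (q * j / Real.exp 1) ^ (q * j) := by positivity
  generalize (((q : ℝ) + 1) * j / Real.exp 1) ^ ((q + 1) * j) = P at *
  generalize ((q : ℝ) ^ q / ((q : ℝ) + 1) ^ (q + 1)) ^ j = R at *
  generalize ((j : ℝ) / Real.exp 1) ^ j = Q1 at *
  generalize ((q : ℝ) * j / Real.exp 1) ^ (q * j) = Q2 at *
  have e3 : 0 < √(2 * (j : ℝ)) := by positivity
  have e4 : 0 < √(2 * ((q : ℝ) * j)) := by positivity
  generalize √(2 * (j : ℝ)) = r1 at *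
  generalize √(2 * ((q : ℝ) * j)) = r2 at *
  generalize √(2 * (((q : ℝ) + 1) * j)) = r3 at *
  generalize √(j : ℝ) = r4 at *
  have : s1 * (r3 * P) / (s2 * (r1 * Q1) * (s3 * (r2 * Q2))) * R * r4
    = s1 * r3 * (P * R) / (s2 * (r1 * Q1) * (s3 * (r2 * Q2))) * r4 := by ring
  rw [this, hpow]
  field_simp

theorem aq_rate0 (q : ℕ) (hq : 1 ≤ q) :
    (fun j => aq q j * √j - Aq q / √Real.pi) =O[atTop] (fun j : ℕ => 1 / (j : ℝ)) := by
  have hpi : 0 < √Real.pi := Real.sqrt_pos.mpr Real.pi_pos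
  have tm (c : ℕ) (hc : 1 ≤ c) : Tendsto (fun j : ℕ => c * j) atTop atTop :=
    tendsto_id.const_mul_atTop' (by omega)
  have st (c : ℕ) (hc : 1 ≤ c) : (fun j : ℕ => Stirling.stirlingSeq (c * j) - √Real.pi)
      =O[atTop] (fun j : ℕ => 1 / (j : ℝ)) := by
    refine (stirling_rate.comp_tendsto (tm c hc)).trans ?_
    refine IsBigO.of_bound 1 ?_
    filter_upwards [eventually_ge_atTop 1] with j hj
    have hj' : (1 : ℝ) ≤ j := by exact_mod_cast hj
    have hc' : (1 : ℝ) ≤ c := by exact_mod_cast hc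
    simp only [Function.comp]
    push_cast
    rw [Real.norm_of_nonneg (by positivity), Real.norm_of_nonneg (by positivity), one_mul]
    apply one_div_le_one_div_of_le <;> nlinarith
  have lim (c : ℕ) (hc : 1 ≤ c) : Tendsto (fun j : ℕ => Stirling.stirlingSeq (c * j)) atTop
      (𝓝 √Real.pi) := Stirling.tendsto_stirlingSeq_sqrt_pi.comp (tm c hc)
  have l1 := lim 1 le_rfl
  have s1 := st 1 le_rfl
  simp only [one_mul] at l1 s1
  have num : (fun j : ℕ => √Real.pi * (Stirling.stirlingSeq ((q + 1) * j) - √Real.pi)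
      - ((Stirling.stirlingSeq j - √Real.pi) * Stirling.stirlingSeq (q * j)
      + √Real.pi * (Stirling.stirlingSeq (q * j) - √Real.pi))) =O[atTop]
      (fun j : ℕ => 1 / (j : ℝ)) := by
    refine ((st (q + 1) (by omega)).const_mul_left _).sub (IsBigO.add ?_
      ((st q hq).const_mul_left _))
    simpa using s1.mul ((lim q hq).isBigO_one ℝ)
  have den : (fun j : ℕ => Aq q * (√Real.pi * (Stirling.stirlingSeq j *
      Stirling.stirlingSeq (q * j)))⁻¹) =O[atTop] (fun _ => (1 : ℝ)) := by
    refine Tendsto.isBigO_one (c := Aq q * (√Real.pi * (√Real.pi * √Real.pi))⁻¹) ℝ ?_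
    exact ((((l1.mul (lim q hq)).const_mul _).inv₀ (by positivity)).const_mul _)
  have := num.mul den
  simp only [mul_one] at this
  refine this.congr' ?_ EventuallyEq.rfl
  filter_upwards [eventually_ge_atTop 1] with j hj
  rw [aq_eq q j hq hj]
  have p1 := hpi.trans_le (Stirling.sqrt_pi_le_stirlingSeq (n := j) (by omega))
  have p2 := hpi.trans_le (Stirling.sqrt_pi_le_stirlingSeq (n := q * j)
    (Nat.mul_pos hq hj).ne')
  field_simp
  ring

theorem aq_rate1 (q : ℕ) (hq : 1 ≤ q) :
    (fun j => aq q j * √((j : ℝ) + 1) - Aq q / √Real.pi) =O[atTop] (fun j => xs j ^ 2) := by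
  have h0 := (aq_rate0 q hq).trans inv_isBigO
  have hb : (fun j => aq q j * √j) =O[atTop] (fun _ => (1 : ℝ)) := by
    have h1 : (fun _ : ℕ => Aq q / √Real.pi) =O[atTop] (fun _ => (1 : ℝ)) :=
      isBigO_const_const _ one_ne_zero _
    have h2 : (fun j => xs j ^ 2) =O[atTop] (fun _ => (1 : ℝ)) :=
      (xs_tendsto.pow 2).isBigO_one ℝ
    simpa using (h0.trans h2).add h1
  have hr : (fun j : ℕ => √(1 + 1 / (j : ℝ)) - 1) =O[atTop] (fun j => xs j ^ 2) := by
    refine IsBigO.trans ?_ inv_isBigO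
    refine IsBigO.of_bound 1 (Eventually.of_forall fun j => ?_)
    have hj : (0 : ℝ) ≤ 1 / j := by positivity
    have h1 : 1 ≤ √(1 + 1 / (j : ℝ)) := Real.one_le_sqrt.mpr (by linarith)
    have h2 : √(1 + 1 / (j : ℝ)) ≤ 1 + 1 / j := by
      rw [Real.sqrt_le_left (by positivity)]; nlinarith
    rw [Real.norm_of_nonneg (by linarith), Real.norm_of_nonneg hj]
    linarith
  have := (hb.mul hr)
  simp only [one_mul] at this
  refine (this.add h0).congr' ?_ EventuallyEq.rfl
  filter_upwards [eventually_ge_atTop 1] with j hj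
  have hj' : (0 : ℝ) < j := by exact_mod_cast hj
  have : √((j : ℝ) + 1) = √j * √(1 + 1 / (j : ℝ)) := by
    rw [← Real.sqrt_mul hj'.le]; congr 1; field_simp
  rw [this]; ring

theorem aq_rate2 (q : ℕ) (hq : 1 ≤ q) :
    (fun j => aq q j - Aq q / √Real.pi * xs j) =O[atTop] (fun j => xs j ^ 3) := by
  refine ((aq_rate1 q hq).mul (isBigO_refl xs atTop)).congr ?_ ?_
  · intro j
    have : √((j : ℝ) + 1) * xs j = 1 := by
      unfold xs; field_simp
    linear_combination (aq q j) * this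
  · intro j; ring

theorem aq_isBigO (q : ℕ) (hq : 1 ≤ q) : aq q =O[atTop] xs := by
  have := ((aq_rate2 q hq).trans xs_cube_isBigO).add
    ((isBigO_refl xs atTop).const_mul_left (Aq q / √Real.pi))
  simpa using this

theorem Aq_one : Aq 1 = 1 := by
  unfold Aq; norm_num

theorem aq_cmp (q : ℕ) (hq : 1 ≤ q) :
    (fun j => aq q j - Aq q * aq 1 j) =O[atTop] (fun j => xs j ^ 3) := by
  have h1 := aq_rate2 q hq
  have h2 := (aq_rate2 1 le_rfl).const_mul_left (Aq q)
  rw [Aq_one] at h2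
  refine (h1.sub h2).congr_left (fun j => ?_)
  ring

theorem bq_cmp (q : ℕ) (hq : 1 ≤ q) :
    (fun j : ℕ => j * aq q j / (q * j + 1) - Aq q / q * aq 1 j) =O[atTop] (fun j => xs j ^ 3) := by
  have hq' : (1 : ℝ) ≤ q := by exact_mod_cast hq
  have h1 := (aq_cmp q hq).const_mul_left (1 / (q : ℝ))
  have h2 : (fun j : ℕ => 1 / (q * (q * (j : ℝ) + 1))) =O[atTop] (fun j => xs j ^ 2) := by
    refine IsBigO.of_bound 1 (Eventually.of_forall fun j => ?_)
    have hj : (0 : ℝ) ≤ j := by positivity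
    rw [xs_sq, Real.norm_of_nonneg (by positivity), Real.norm_of_nonneg (by positivity), one_mul]
    apply one_div_le_one_div_of_le (by positivity)
    have : (j : ℝ) ≤ q * j := by nlinarith
    nlinarith
  have h3 := (aq_isBigO q hq).mul h2
  have h4 : (fun j => xs j * xs j ^ 2) = (fun j => xs j ^ 3) := by ext j; ring
  rw [h4] at h3
  refine (h1.sub h3).congr_left (fun j => ?_)
  field_simp
  ring

theorem sum_aq_one (m : ℕ) :
    ∑ p ∈ Finset.HasAntidiagonal.antidiagonal m, aq 1 p.1 * aq 1 p.2 = 1 := by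
  have h := sum_central m
  have e : ∀ p ∈ Finset.HasAntidiagonal.antidiagonal m, aq 1 p.1 * aq 1 p.2
      = ((2 * p.1).choose p.1 : ℝ) * ((2 * p.2).choose p.2 : ℝ) * (1 / 4) ^ m := by
    intro p hp
    have : p.1 + p.2 = m := by simpa using hp
    rw [← this, pow_add]
    unfold aq
    norm_num
    ring
  rw [Finset.sum_congr rfl e, ← Finset.sum_mul, h, ← mul_pow]
  norm_num

theorem pq_rate (q : ℕ) (hq : 1 ≤ q) :
    (fun m => ∑ p ∈ Finset.HasAntidiagonal.antidiagonal m,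
      (p.1 * aq q p.1 / (q * p.1 + 1)) * aq q p.2 - Aq q ^ 2 / q) =O[atTop] xs := by
  have h := conv_isBigO (bq_cmp q hq) (aq_cmp q hq)
    ((aq_isBigO 1 le_rfl).const_mul_left _) (aq_isBigO q hq)
  refine h.congr_left (fun m => ?_)
  congr 1
  have : ∀ p ∈ Finset.HasAntidiagonal.antidiagonal m, Aq q / q * aq 1 p.1 * (Aq q * aq 1 p.2)
    = Aq q ^ 2 / q * (aq 1 p.1 * aq 1 p.2) := by intros; ring
  rw [Finset.sum_congr rfl this, ← Finset.mul_sum, sum_aq_one, mul_one]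

theorem expIPL_formula (q m : ℕ) (hq : 1 ≤ q) : expIPL (q + 1) (m + 1) =
    (q * m + 1) * (∑ p ∈ Finset.HasAntidiagonal.antidiagonal m,
      (p.1 * aq q p.1 / (q * p.1 + 1)) * aq q p.2) / aq q m := by
  have hq' : (1 : ℝ) ≤ q := by exact_mod_cast hq
  rw [expIPL_eq, Nat.add_sub_cancel, coeff_gP _ (by omega)]
  have hT (j : ℕ) : PowerSeries.coeff j (gT (q + 1)) =
      (((q + 1) * j).choose j : ℝ) / (q * j + 1) := by
    rw [eq_div_iff (by positivity), ← coeff_gT (q + 1) (by omega) j]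
    push_cast; ring
  obtain ⟨ρ, hρ⟩ : ∃ ρ : ℝ, ρ = (q : ℝ) ^ q / ((q : ℝ) + 1) ^ (q + 1) := ⟨_, rfl⟩
  have hρ0 : 0 < ρ := by rw [hρ]; positivity
  have e : ∀ p ∈ Finset.HasAntidiagonal.antidiagonal m,
      (p.1 * aq q p.1 / (q * p.1 + 1)) * aq q p.2
      = (p.1 * PowerSeries.coeff p.1 (gT (q + 1))) * (((q + 1) * p.2).choose p.2 : ℝ) * ρ ^ m := by
    intro p hp
    have : p.1 + p.2 = m := by simpa using hp
    rw [hT, ← this, pow_add]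
    unfold aq
    rw [← hρ]
    ring
  rw [Finset.sum_congr rfl e, ← Finset.sum_mul, hT]
  unfold aq
  rw [← hρ]
  have hc : (0 : ℝ) < (((q + 1) * m).choose m : ℝ) := by
    exact_mod_cast Nat.choose_pos (by nlinarith)
  have hρm := pow_pos hρ0 m
  field_simp

/-- For a uniformly random `k`-regular tree with `n`
interior nodes, `E[IPL(T)] = √(π k n³/(2(k-1))) (1 + O(n^{-1/2}))`. -/
theorem expIPL_asymptotics (k : ℕ) (hk : 2 ≤ k) :
    ∃ M : ℝ, 0 < M ∧ ∀ n : ℕ, 1 ≤ n →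
      |expIPL k n /
          Real.sqrt (Real.pi * (k : ℝ) * (n : ℝ) ^ 3 / (2 * ((k : ℝ) - 1))) - 1| ≤
        M * (n : ℝ) ^ (-(1 : ℝ) / 2) := by
  obtain ⟨q, rfl⟩ : ∃ q, k = q + 1 := ⟨k - 1, by omega⟩
  have hq : 1 ≤ q := by omega
  have hq' : (1 : ℝ) ≤ q := by exact_mod_cast hq
  have hpi : 0 < √Real.pi := Real.sqrt_pos.mpr Real.pi_pos
  have hA : 0 < Aq q := by unfold Aq; positivity
  obtain ⟨p, hp⟩ : ∃ p : ℕ → ℝ, p = fun m => ∑ p ∈ Finset.HasAntidiagonal.antidiagonal m,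
      (p.1 * aq q p.1 / (q * p.1 + 1)) * aq q p.2 := ⟨_, rfl⟩
  have hP : (fun m => p m - Aq q ^ 2 / q) =O[atTop] xs := by rw [hp]; exact pq_rate q hq
  have hPb : p =O[atTop] (fun _ => (1 : ℝ)) := by
    have h1 : (fun _ : ℕ => Aq q ^ 2 / q) =O[atTop] (fun _ => (1 : ℝ)) :=
      isBigO_const_const _ one_ne_zero _
    simpa using (hP.trans (xs_tendsto.isBigO_one ℝ)).add h1
  have hN : (fun m : ℕ => (q * m + 1) / ((m : ℝ) + 1) * p m - Aq q ^ 2) =O[atTop] xs := by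
    have h1 : (fun m => (q : ℝ) * (p m - Aq q ^ 2 / q) - (q - 1) * (xs m ^ 2 * p m))
        =O[atTop] xs := by
      refine (hP.const_mul_left _).sub (IsBigO.const_mul_left ?_ _)
      simpa using xs_sq_isBigO.mul hPb
    refine h1.congr_left (fun m => ?_)
    rw [xs_sq]
    field_simp
    ring
  have hD : (fun m : ℕ => aq q m * √((m : ℝ) + 1) - Aq q / √Real.pi) =O[atTop] xs :=
    (aq_rate1 q hq).trans xs_sq_isBigO
  have hDt : Tendsto (fun m : ℕ => aq q m * √((m : ℝ) + 1)) atTop (𝓝 (Aq q / √Real.pi)) := by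
    have := (hD.trans_tendsto xs_tendsto).add_const (Aq q / √Real.pi)
    simpa using this
  have hDi : (fun m : ℕ => (√Real.pi * Aq q * (aq q m * √((m : ℝ) + 1)))⁻¹)
      =O[atTop] (fun _ => (1 : ℝ)) :=
    ((hDt.const_mul (√Real.pi * Aq q)).inv₀ (by positivity)).isBigO_one ℝ
  have hR := (hN.sub (hD.const_mul_left (√Real.pi * Aq q))).mul hDi
  simp only [mul_one] at hR
  obtain ⟨M, hM, hb⟩ := bound_all (r := 1) (by simpa using hR)
  refine ⟨M, hM, fun n hn => ?_⟩
  obtain ⟨m, rfl⟩ : ∃ m, n = m + 1 := ⟨n - 1, by omega⟩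
  have hx : (((m + 1 : ℕ) : ℝ)) ^ (-(1 : ℝ) / 2) = xs m := by
    unfold xs
    rw [neg_div, Real.rpow_neg (by positivity), Real.sqrt_eq_rpow]
    push_cast; simp
  rw [hx]
  have := hb m
  rw [pow_one] at this
  refine le_of_eq_of_le ?_ this
  congr 1
  have ha : 0 < aq q m := by
    unfold aq
    have : (0 : ℝ) < (((q + 1) * m).choose m : ℝ) := by
      exact_mod_cast Nat.choose_pos (by nlinarith)
    positivity
  have hs : √(Real.pi * ((q + 1 : ℕ) : ℝ) * ((m + 1 : ℕ) : ℝ) ^ 3 / (2 * (((q + 1 : ℕ) : ℝ) - 1)))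
      = √Real.pi * Aq q * (((m : ℝ) + 1) * √((m : ℝ) + 1)) := by
    have e : Real.pi * ((q + 1 : ℕ) : ℝ) * ((m + 1 : ℕ) : ℝ) ^ 3 / (2 * (((q + 1 : ℕ) : ℝ) - 1))
      = Real.pi * (((q : ℝ) + 1) / (2 * q)) * (((m : ℝ) + 1) ^ 2 * ((m : ℝ) + 1)) := by
      push_cast; rw [add_sub_cancel_right]; field_simp
    rw [e, Real.sqrt_mul (by positivity), Real.sqrt_mul (by positivity),
      Real.sqrt_mul (by positivity), Real.sqrt_sq (by positivity)]
    rfl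
  rw [hs, expIPL_formula q m hq]
  have : (∑ p ∈ Finset.HasAntidiagonal.antidiagonal m,
      ((p.1 : ℝ) * aq q p.1 / (q * p.1 + 1)) * aq q p.2) = p m := by rw [hp]
  rw [this]
  have hr : 0 < √((m : ℝ) + 1) := by positivity
  field_simp
  ring
end

section
/- Let k ≥ 2 and n ≥ 1, and let T be chosen uniformly at random from the (finite, nonempty) set of k-regular trees with exactly n interior nodes. Then Var[IPL(T)] = (k/(2(k−1)))·(10/3 − π)·n³·(1 + O(n^{−1/2})); that is, there exists a constant M > 0 (depending only on k) such that for all n ≥ 1, | Var[IPL(T)] / ((k/(2(k−1)))(10/3 − π) n³) − 1 | ≤ M·n^{−1/2}. -/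
namespace KTree

variable {k : ℕ}

lemma finite_le_s18 (m : ℕ) : {t : KTree k | t.numNodes ≤ m}.Finite := by
  induction m with
  | zero =>
    refine (Set.finite_singleton (leaf : KTree k)).subset ?_
    rintro (_ | f) h
    · simp
    · simp [numNodes] at h
  | succ m ih =>
    have h2 : (Set.pi Set.univ (fun _ : Fin k => {t : KTree k | t.numNodes ≤ m})).Finite :=
      Set.Finite.pi' (fun _ => ih) |>.subset (by intro f hf; simpa [Set.mem_pi] using hf)
    refine ((Set.finite_singleton (leaf : KTree k)).union (h2.image node)).subset ?_
    rintro (_ | f) h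
    · simp
    · right
      refine ⟨f, ?_, rfl⟩
      intro i _
      simp only [Set.mem_ofPred_eq, numNodes] at h ⊢
      have := Finset.single_le_sum (f := fun i => numNodes (f i)) (fun _ _ => Nat.zero_le _)
        (Finset.mem_univ i)
      omega

lemma finite_eq_s18 (k m : ℕ) : {t : KTree k | t.numNodes = m}.Finite :=
  (finite_le_s18 m).subset (fun _ h => le_of_eq h)

/-- The finite set of trees with `m` internal nodes. -/
noncomputable def sz (k m : ℕ) : Finset (KTree k) := (finite_eq_s18 k m).toFinset

lemma mem_sz {m : ℕ} {t : KTree k} : t ∈ sz k m ↔ t.numNodes = m := by simp [sz]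

/-- Generating function of a weight. -/
noncomputable def gf (g : KTree k → ℝ) : PowerSeries ℝ := PowerSeries.mk fun m => ∑ t ∈ sz k m, g t

lemma coeff_gf (g : KTree k → ℝ) (m : ℕ) : PowerSeries.coeff m (gf g) = ∑ t ∈ sz k m, g t := by
  simp [gf]

/-- Functions supported on nonleaf trees. -/
def nl (F : (Fin k → KTree k) → ℝ) : KTree k → ℝ
  | leaf => 0
  | node f => F f

lemma sz_zero : sz k 0 = {leaf} := by
  ext t
  rw [mem_sz]
  cases t <;> simp [numNodes]

lemma node_inj : Function.Injective (node : (Fin k → KTree k) → KTree k) := by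
  intro f g h
  exact (node.injEq f g).mp h

open Classical in
lemma sum_nl_succ (F : (Fin k → KTree k) → ℝ) (m : ℕ) :
    ∑ t ∈ sz k (m+1), nl F t =
      ∑ v ∈ Finset.piAntidiag Finset.univ m, ∑ f ∈ Fintype.piFinset (fun i => sz k (v i)), F f := by
  rw [Finset.sum_sigma']
  symm
  refine Finset.sum_bij (fun p _ => node p.2) ?_ ?_ ?_ ?_
  · rintro ⟨v, f⟩ h
    simp only [Finset.mem_sigma, Finset.mem_piAntidiag, Fintype.mem_piFinset, mem_sz] at h
    simp only [mem_sz, numNodes]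
    rw [Finset.sum_congr rfl (fun i _ => h.2 i), h.1.1, add_comm]
  · rintro ⟨v, f⟩ h ⟨v', f'⟩ h' he
    simp only [Finset.mem_sigma, Finset.mem_piAntidiag, Fintype.mem_piFinset, mem_sz] at h h'
    have : f = f' := node_inj he
    subst this
    have : v = v' := by
      ext i
      rw [← h.2 i, ← h'.2 i]
    subst this
    rfl
  · rintro (_ | f) h
    · simp [mem_sz, numNodes] at h
    · rw [mem_sz, numNodes] at h
      refine ⟨⟨fun i => numNodes (f i), f⟩, ?_, rfl⟩
      simp [mem_sz]
      omega
  · intros; rfl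

lemma gf_nl (g : Fin k → KTree k → ℝ) :
    gf (nl fun f => ∏ i, g i (f i)) = PowerSeries.X * ∏ i, gf (g i) := by
  classical
  ext m
  rw [coeff_gf]
  cases m with
  | zero => simp [sz_zero, nl]
  | succ m =>
    rw [sum_nl_succ, PowerSeries.coeff_succ_X_mul, PowerSeries.coeff_prod, 
      Finset.sum_congr rfl (fun v _ => (Finset.prod_univ_sum (fun i => sz k (v i)) g).symm)]
    refine Finset.sum_nbij' (fun v => Finsupp.equivFunOnFinite.symm v) (fun l => l) ?_ ?_ ?_ ?_ ?_
    · intro v hv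
      simp only [Finset.mem_piAntidiag] at hv
      simp [Finset.mem_finsuppAntidiag, hv.1]
    · intro l hl
      simp only [Finset.mem_finsuppAntidiag] at hl
      simp [Finset.mem_piAntidiag, hl.1]
    · intros; rfl
    · intros; ext; rfl
    · intros; simp [coeff_gf]

lemma gf_add (g h : KTree k → ℝ) : gf (fun t => g t + h t) = gf g + gf h := by
  ext m; simp [coeff_gf, Finset.sum_add_distrib]

lemma gf_sub (g h : KTree k → ℝ) : gf (fun t => g t - h t) = gf g - gf h := by
  ext m; simp [coeff_gf, Finset.sum_sub_distrib]

lemma gf_const_mul (c : ℝ) (g : KTree k → ℝ) :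
    gf (fun t => c * g t) = PowerSeries.C c * gf g := by
  ext m; simp [coeff_gf, Finset.mul_sum]

lemma gf_sum {ι : Type*} (s : Finset ι) (g : ι → KTree k → ℝ) :
    gf (fun t => ∑ i ∈ s, g i t) = ∑ i ∈ s, gf (g i) := by
  ext m
  simp only [coeff_gf, map_sum]
  exact Finset.sum_comm

/-- Euler operator. -/
noncomputable def D (f : PowerSeries ℝ) : PowerSeries ℝ :=
  PowerSeries.X * PowerSeries.derivative ℝ f

lemma coeff_D (f : PowerSeries ℝ) (m : ℕ) :
    PowerSeries.coeff m (D f) = m * PowerSeries.coeff m f := by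
  unfold D
  cases m with
  | zero => simp
  | succ m =>
    rw [PowerSeries.coeff_succ_X_mul]
    simp [PowerSeries.coeff_derivative, mul_comm]

lemma D_mul (f g : PowerSeries ℝ) : D (f * g) = D f * g + f * D g := by
  simp only [D, Derivation.leibniz, smul_eq_mul]; ring

lemma D_add (f g : PowerSeries ℝ) : D (f + g) = D f + D g := by
  simp only [D, map_add]; ring

lemma D_sub (f g : PowerSeries ℝ) : D (f - g) = D f - D g := by
  simp only [D, map_sub]; ring

lemma D_C (c : ℝ) : D (PowerSeries.C c) = 0 := by
  ext m
  rw [coeff_D, PowerSeries.coeff_C]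
  split_ifs with h <;> simp [h]

lemma gf_num (g : KTree k → ℝ) : gf (fun t => (t.numNodes : ℝ) * g t) = D (gf g) := by
  ext m
  rw [coeff_D, coeff_gf, coeff_gf, Finset.mul_sum]
  refine Finset.sum_congr rfl fun t ht => ?_
  rw [mem_sz.mp ht]

/-- weights -/
noncomputable def R (t : KTree k) : ℝ := (iplReg t : ℝ)

lemma R_leaf : R (leaf : KTree k) = 0 := by simp [R, iplReg, ipl, numNodes]

lemma R_node (f : Fin k → KTree k) :
    R (node f) = ∑ i, R (f i) + ((node f).numNodes : ℝ) := by
  simp only [R, iplReg, ipl]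
  push_cast
  ring

/-- tree series -/
noncomputable def TT (k : ℕ) : PowerSeries ℝ := gf (fun _ : KTree k => 1)
/-- first moment series -/
noncomputable def GG (k : ℕ) : PowerSeries ℝ := gf (fun t : KTree k => R t)
/-- second moment series -/
noncomputable def QQ (k : ℕ) : PowerSeries ℝ := gf (fun t : KTree k => R t ^ 2)

lemma TT_eq : TT k = 1 + PowerSeries.X * TT k ^ k := by
  have h := gf_nl (k := k) (fun _ _ => 1)
  simp only [Finset.prod_const_one, Finset.prod_const, Finset.card_univ, Fintype.card_fin] at h
  change _ = PowerSeries.X * TT k ^ k at h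
  rw [← h]
  ext m
  cases m with
  | zero => rw [map_add, TT, coeff_gf, coeff_gf]; simp [sz_zero, nl]
  | succ m =>
    simp only [TT, coeff_gf, map_add, PowerSeries.coeff_one]
    simp only [Nat.add_eq_zero_iff, one_ne_zero, and_false, if_false, zero_add]
    refine Finset.sum_congr rfl fun t ht => ?_
    cases t with
    | leaf => simp [mem_sz, numNodes] at ht
    | node f => rfl

lemma gf_nl_one (a : KTree k → ℝ) (i : Fin k) :
    gf (nl fun f => a (f i)) = PowerSeries.X * TT k ^ (k-1) * gf a := by
  classical
  have h := gf_nl (k := k) (fun j => if j = i then a else fun _ => 1)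
  have e : (fun f : Fin k → KTree k => ∏ j, (if j = i then a else fun _ => 1) (f j)) =
      fun f => a (f i) := by
    ext f
    rw [Finset.prod_eq_single i]
    · simp
    · intro b _ hb; simp [hb]
    · simp
  rw [e] at h
  rw [h, ← Finset.mul_prod_erase _ _ (Finset.mem_univ i)]
  simp only [if_true]
  rw [Finset.prod_congr rfl (g := fun _ => TT k)]
  · simp; ring
  · intro j hj
    rw [if_neg (Finset.ne_of_mem_erase hj)]; rfl

lemma gf_nl_two (a b : KTree k → ℝ) (i j : Fin k) (hij : i ≠ j) :
    gf (nl fun f => a (f i) * b (f j)) = PowerSeries.X * TT k ^ (k-2) * (gf a * gf b) := by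
  classical
  have h := gf_nl (k := k) (fun l => if l = i then a else if l = j then b else fun _ => 1)
  have hj : j ∈ Finset.univ.erase i := by simp [hij.symm]
  have e : (fun f : Fin k → KTree k => ∏ l, (if l = i then a else if l = j then b else fun _ => 1) (f l)) =
      fun f => a (f i) * b (f j) := by
    ext f
    rw [← Finset.mul_prod_erase _ _ (Finset.mem_univ i), ← Finset.mul_prod_erase _ _ hj,
      Finset.prod_eq_one]
    · simp [hij.symm]
    · intro l hl
      simp only [Finset.mem_erase] at hl
      simp [hl.1, hl.2.1]
  rw [e] at h
  rw [h, ← Finset.mul_prod_erase _ _ (Finset.mem_univ i), ← Finset.mul_prod_erase _ _ hj]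
  rw [Finset.prod_congr rfl (g := fun _ => TT k)]
  · have : (Finset.univ.erase i).card - 1 = k - 2 := by simp; omega
    simp only [if_true, if_neg hij.symm, Finset.prod_const, Finset.card_erase_of_mem hj, this]
    ring
  · intro l hl
    simp only [Finset.mem_erase] at hl
    rw [if_neg hl.2.1, if_neg hl.1]; rfl

lemma GG_eq : GG k = (k : PowerSeries ℝ) * (PowerSeries.X * TT k ^ (k-1)) * GG k + D (TT k) := by
  have h1 : (fun t : KTree k => R t) =
      fun t => ∑ i, nl (fun f => R (f i)) t + (t.numNodes : ℝ) * 1 := by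
    ext t
    cases t with
    | leaf => simp [R_leaf, nl, numNodes]
    | node f => simp [R_node, nl]
  have h2 : GG k = gf (fun t : KTree k => ∑ i, nl (fun f => R (f i)) t + (t.numNodes : ℝ) * 1) := by
    rw [← h1]; rfl
  rw [gf_add, gf_num, gf_sum] at h2
  simp only [gf_nl_one] at h2
  simp only [Finset.sum_const, Finset.card_univ, Fintype.card_fin, nsmul_eq_mul] at h2
  change GG k = (k : PowerSeries ℝ) * (PowerSeries.X * TT k ^ (k-1) * GG k) + D (TT k) at h2
  rw [mul_assoc]
  exact h2

lemma QQ_eq : QQ k = (k : PowerSeries ℝ) * (PowerSeries.X * TT k ^ (k-1)) * QQ k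
    + (k : PowerSeries ℝ) * ((k : PowerSeries ℝ)-1) * (PowerSeries.X * TT k ^ (k-2)) * GG k ^ 2 + 2 * D (GG k) - D (D (TT k)) := by
  classical
  have h1 : (fun t : KTree k => R t ^ 2) =
      fun t => ((∑ i, nl (fun f => R (f i) ^ 2) t
        + ∑ p ∈ (Finset.univ : Finset (Fin k)).offDiag, nl (fun f => R (f p.1) * R (f p.2)) t)
        + 2 * ((t.numNodes : ℝ) * R t)) - (t.numNodes : ℝ) * ((t.numNodes : ℝ) * 1) := by
    ext t
    cases t with
    | leaf => simp [R_leaf, nl, numNodes]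
    | node f =>
      simp only [nl]
      have : ∑ i, R (f i) ^ 2 + ∑ p ∈ (Finset.univ : Finset (Fin k)).offDiag, R (f p.1) * R (f p.2)
          = (∑ i, R (f i)) ^ 2 := by
        rw [sq, Finset.sum_mul_sum, ← Finset.sum_product', ← Finset.diag_union_offDiag,
          Finset.sum_union (Finset.disjoint_diag_offDiag _), Finset.sum_diag]
        simp [sq]
      rw [this, R_node]
      ring
  have h2 : QQ k = gf (fun t : KTree k => R t ^ 2) := rfl
  rw [h1, gf_sub, gf_add, gf_add, gf_sum, gf_sum, gf_const_mul, gf_num, gf_num, gf_num] at h2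
  simp only [gf_nl_one (fun t => R t ^ 2)] at h2
  rw [Finset.sum_congr (s₁ := Finset.offDiag _) rfl (g := fun _ => PowerSeries.X * TT k ^ (k-2) * (GG k * GG k))] at h2
  · simp only [Finset.sum_const, Finset.offDiag_card, Finset.card_univ, Fintype.card_fin,
      nsmul_eq_mul] at h2
    have hc : ((k * k - k : ℕ) : PowerSeries ℝ) = k * (k - 1) := by
      rw [Nat.cast_sub (Nat.le_mul_self k), Nat.cast_mul]; ring
    rw [hc] at h2
    have h3 : (PowerSeries.C (2:ℝ)) = 2 := map_ofNat PowerSeries.C 2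
    rw [h3] at h2
    change QQ k = (k : PowerSeries ℝ) * (PowerSeries.X * TT k ^ (k-1) * QQ k)
      + (k : PowerSeries ℝ) * ((k : PowerSeries ℝ)-1) * (PowerSeries.X * TT k ^ (k-2) * (GG k * GG k)) + 2 * D (GG k) - D (D (TT k)) at h2
    linear_combination h2
  · intro p hp
    rw [Finset.mem_offDiag] at hp
    rw [gf_nl_two _ _ _ _ hp.2.2]; rfl

end KTree

namespace KTree

variable {k : ℕ}

/-- the series `1/(1 - k X T^(k-1))` -/
noncomputable def VV (k : ℕ) : PowerSeries ℝ :=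
  (1 - (k : PowerSeries ℝ) * (PowerSeries.X * TT k ^ (k-1)))⁻¹

lemma VV_mul : VV k * (1 - (k : PowerSeries ℝ) * (PowerSeries.X * TT k ^ (k-1))) = 1 := by
  unfold VV
  rw [mul_comm]
  apply PowerSeries.mul_inv_cancel
  simp

lemma TT_ne : TT k ≠ 0 := by
  intro h
  have h1 := congrArg (PowerSeries.coeff 0) (TT_eq (k := k))
  rw [map_add, PowerSeries.coeff_zero_X_mul, h] at h1
  simp at h1

lemma pow_one_eq (hk : 2 ≤ k) : PowerSeries.X * TT k ^ (k-1) = (PowerSeries.X * TT k ^ (k-2)) * TT k := by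
  obtain ⟨q, rfl⟩ := Nat.exists_eq_add_of_le hk
  have : 2 + q - 1 = q + 1 := by omega
  rw [this, show 2 + q - 2 = q by omega, pow_succ]; ring

lemma pow_zero_eq (hk : 2 ≤ k) : PowerSeries.X * TT k ^ k = (PowerSeries.X * TT k ^ (k-2)) * TT k ^ 2 := by
  obtain ⟨q, rfl⟩ := Nat.exists_eq_add_of_le hk
  rw [show 2 + q - 2 = q by omega, pow_add]; ring

lemma D_one : D (1 : PowerSeries ℝ) = 0 := by
  have := D_C 1
  rwa [map_one] at this

lemma D_X : D (PowerSeries.X : PowerSeries ℝ) = PowerSeries.X := by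
  simp [D]

lemma D_pow (f : PowerSeries ℝ) (j : ℕ) :
    D (f ^ j) = (j : PowerSeries ℝ) * f ^ (j-1) * D f := by
  unfold D
  rw [Derivation.leibniz_pow]
  simp only [nsmul_eq_mul, smul_eq_mul]
  ring

lemma D_TT : D (TT k) = PowerSeries.X * TT k ^ k
    + (k : PowerSeries ℝ) * (PowerSeries.X * TT k ^ (k-1)) * D (TT k) := by
  conv_lhs => rw [TT_eq]
  rw [D_add, D_one, D_mul, D_X, D_pow]
  ring

lemma D_natCast (j : ℕ) : D (j : PowerSeries ℝ) = 0 := by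
  have := D_C (j : ℝ)
  rwa [map_natCast] at this

/-- the series `T - 1` -/
noncomputable def WW (k : ℕ) : PowerSeries ℝ := PowerSeries.X * TT k ^ k

lemma TT_WW : TT k = 1 + WW k := TT_eq

lemma D_TT' : D (TT k) = WW k * VV k := by
  have h := D_TT (k := k)
  have hv := VV_mul (k := k)
  unfold WW
  linear_combination (VV k) * h - (D (TT k)) * hv

lemma GG_eq' : GG k = WW k * VV k ^ 2 := by
  have h := GG_eq (k := k)
  have hv := VV_mul (k := k)
  rw [D_TT'] at h
  linear_combination (VV k) * h - (GG k) * hv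

lemma V_rel (hk : 2 ≤ k) : (k : PowerSeries ℝ) * VV k - ((k : PowerSeries ℝ) - 1) * TT k * VV k = TT k := by
  have hv := VV_mul (k := k)
  have h1 := TT_eq (k := k)
  rw [pow_zero_eq hk] at h1
  rw [pow_one_eq hk] at hv
  linear_combination (TT k) * hv - (k : PowerSeries ℝ) * VV k * h1

lemma V_rel2 (hk : 2 ≤ k) : (k : PowerSeries ℝ) * WW k * VV k = TT k * (VV k - 1) := by
  have := V_rel hk
  have h2 := TT_WW (k := k)
  linear_combination -this - (k : PowerSeries ℝ) * VV k * h2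

lemma D_WW : D (WW k) = WW k * VV k := by
  have := D_TT' (k := k)
  rw [TT_WW, D_add, D_one] at this
  simpa using this

lemma D_VV (hk : 2 ≤ k) : (k : PowerSeries ℝ) * D (VV k) =
    VV k * (VV k - 1) * (1 + ((k : PowerSeries ℝ) - 1) * VV k) := by
  have h := congrArg D (V_rel hk)
  have hr := V_rel hk
  have hr2 := V_rel2 hk
  rw [D_sub, D_mul, D_mul, D_mul, D_sub, D_natCast, D_one, D_TT'] at h
  apply mul_left_cancel₀ (TT_ne (k := k))
  linear_combination (k : PowerSeries ℝ) * VV k * h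
    - (k : PowerSeries ℝ) * (D (VV k)) * hr +
    (1 + ((k : PowerSeries ℝ) - 1) * VV k) * VV k * hr2

lemma D_WV (hk : 2 ≤ k) (j : ℕ) : (k : PowerSeries ℝ) * D (WW k * VV k ^ j) =
    (k : PowerSeries ℝ) * (WW k * VV k ^ (j+1)) + (j : PowerSeries ℝ) *
      (((k : PowerSeries ℝ) - 1) * (WW k * VV k ^ (j+2)) -
        ((k : PowerSeries ℝ) - 2) * (WW k * VV k ^ (j+1)) - WW k * VV k ^ j) := by
  rw [D_mul, D_WW, D_pow]
  have h := D_VV hk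
  cases j with
  | zero => simp
  | succ j =>
    simp only [Nat.add_sub_cancel]
    linear_combination (WW k * ((j + 1 : ℕ) : PowerSeries ℝ) * VV k ^ j) * h

lemma QQ_eq' (hk : 2 ≤ k) : (k : PowerSeries ℝ) * QQ k =
    ((k : PowerSeries ℝ) - 1) * (WW k * VV k ^ 5 - 2 * (WW k * VV k ^ 4) + WW k * VV k ^ 3)
    + 2 * (k : PowerSeries ℝ) * (WW k * VV k ^ 4)
    + 4 * (((k : PowerSeries ℝ) - 1) * (WW k * VV k ^ 5) -
        ((k : PowerSeries ℝ) - 2) * (WW k * VV k ^ 4) - WW k * VV k ^ 3)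
    - (k : PowerSeries ℝ) * (WW k * VV k ^ 3)
    - (((k : PowerSeries ℝ) - 1) * (WW k * VV k ^ 4) -
        ((k : PowerSeries ℝ) - 2) * (WW k * VV k ^ 3) - WW k * VV k ^ 2) := by
  have hQ := QQ_eq (k := k)
  have hv := VV_mul (k := k)
  have h1 := D_WV hk 1
  have h2 := D_WV hk 2
  have hr2 := V_rel2 hk
  have hP : (k : PowerSeries ℝ) ^ 2 * (PowerSeries.X * TT k ^ (k-2) * GG k ^ 2)
      = WW k * (VV k - 1) ^ 2 * VV k ^ 2 := by
    apply mul_left_cancel₀ (pow_ne_zero 2 (TT_ne (k := k)))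
    have hz := pow_zero_eq hk
    rw [← WW] at hz
    rw [GG_eq']
    linear_combination (-(k : PowerSeries ℝ) ^ 2 * WW k ^ 2 * VV k ^ 4) * hz
      + WW k * VV k ^ 2 * ((k : PowerSeries ℝ) * WW k * VV k + TT k * (VV k - 1)) * hr2
  have h0 : (k : PowerSeries ℝ) * QQ k = VV k * ((((k : PowerSeries ℝ) - 1) * ((k : PowerSeries ℝ) ^ 2 * (PowerSeries.X * TT k ^ (k-2) * GG k ^ 2))) + 2 * ((k : PowerSeries ℝ) * D (GG k)) - (k : PowerSeries ℝ) * D (D (TT k))) := by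
    linear_combination (k : PowerSeries ℝ) * VV k * hQ - (k : PowerSeries ℝ) * QQ k * hv
  rw [hP, GG_eq', D_TT'] at h0
  simp only [pow_one, Nat.cast_one, Nat.cast_ofNat] at h1 h2
  rw [h0]
  linear_combination (2 * VV k) * h2 - (VV k) * h1

end KTree

namespace KTree

variable {k : ℕ}

lemma coeff_nat_mul (j m : ℕ) (f : PowerSeries ℝ) :
    PowerSeries.coeff m ((j : PowerSeries ℝ) * f) = j * PowerSeries.coeff m f := by
  rw [← map_natCast (PowerSeries.C (R := ℝ)) j, PowerSeries.coeff_C_mul]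

lemma coeff_two_mul (m : ℕ) (f : PowerSeries ℝ) :
    PowerSeries.coeff m (2 * f) = 2 * PowerSeries.coeff m f := by
  exact_mod_cast coeff_nat_mul 2 m f

lemma coeff_four_mul (m : ℕ) (f : PowerSeries ℝ) :
    PowerSeries.coeff m (4 * f) = 4 * PowerSeries.coeff m f := by
  exact_mod_cast coeff_nat_mul 4 m f

/-- coefficients of `W V^j` -/
noncomputable def ee (k j m : ℕ) : ℝ := PowerSeries.coeff m (WW k * VV k ^ j)

lemma ee_rec (hk : 2 ≤ k) (j m : ℕ) : (k : ℝ) * (m * ee k j m) =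
    k * ee k (j+1) m + j * ((k-1) * ee k (j+2) m - (k-2) * ee k (j+1) m - ee k j m) := by
  have h := congrArg (PowerSeries.coeff m) (D_WV hk j)
  simp only [map_add, map_sub, coeff_nat_mul, coeff_D, sub_mul, one_mul, coeff_two_mul] at h
  simp only [ee]
  rw [h]; ring

lemma QQ_coeff (hk : 2 ≤ k) (m : ℕ) : (k : ℝ) * PowerSeries.coeff m (QQ k) =
    (k - 1) * (ee k 5 m - 2 * ee k 4 m + ee k 3 m) + 2 * k * ee k 4 m
    + 4 * ((k-1) * ee k 5 m - (k-2) * ee k 4 m - ee k 3 m) - k * ee k 3 m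
    - ((k-1) * ee k 4 m - (k-2) * ee k 3 m - ee k 2 m) := by
  have h := congrArg (PowerSeries.coeff m) (QQ_eq' hk)
  simp only [map_add, map_sub, coeff_nat_mul, sub_mul, one_mul, coeff_two_mul, coeff_four_mul,
    mul_assoc] at h
  simp only [ee]
  rw [h]; ring

lemma GG_coeff (m : ℕ) : PowerSeries.coeff m (GG k) = ee k 2 m := by
  rw [GG_eq', ee]

lemma coeff0_TT : PowerSeries.coeff 0 (TT k) = 1 := by
  rw [TT_eq, map_add, PowerSeries.coeff_zero_X_mul]; simp

lemma coeff0_VV : PowerSeries.coeff 0 (VV k) = 1 := by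
  have h := congrArg (PowerSeries.coeff 0) (VV_mul (k := k))
  simpa using h

lemma coeff_TV (hk : 2 ≤ k) (m : ℕ) : ∀ a : ℕ,
    PowerSeries.coeff m (TT k ^ a * VV k) = ((k * m + a).choose m : ℝ) := by
  induction m with
  | zero =>
    intro a
    have h1 := coeff0_TT (k := k)
    have h2 := coeff0_VV (k := k)
    simp only [PowerSeries.coeff_zero_eq_constantCoeff] at h1 h2
    simp [h1, h2]
  | succ m ih =>
    have step : ∀ a : ℕ, PowerSeries.coeff (m+1) (TT k ^ (a+1) * VV k) =
        PowerSeries.coeff (m+1) (TT k ^ a * VV k) + ((k * (m+1) + a).choose m : ℝ) := by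
      intro a
      have : TT k ^ (a+1) * VV k = TT k ^ a * VV k + PowerSeries.X * (TT k ^ (a + k) * VV k) := by
        have h := TT_eq (k := k)
        rw [pow_succ, pow_add]
        linear_combination (TT k ^ a * VV k) * h
      rw [this, map_add, PowerSeries.coeff_succ_X_mul, ih, show k * m + (a + k) = k * (m+1) + a by ring]
    intro a
    induction a with
    | zero =>
      have h1 := step 0
      simp only [pow_zero, one_mul, zero_add, pow_one, add_zero] at h1 ⊢
      have h2 := congrArg (PowerSeries.coeff (m+1)) (V_rel hk)
      have h3 := congrArg (PowerSeries.coeff (m+1)) (D_TT' (k := k))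
      have e3 : WW k * VV k = TT k * VV k - VV k := by rw [TT_WW]; ring
      rw [e3, coeff_D] at h3
      simp only [map_sub, sub_mul, one_mul, mul_assoc, coeff_nat_mul] at h2 h3
      have h4 := Nat.choose_succ_right_eq (k * (m+1)) m
      have h5 : k * (m+1) - m + m = k * (m+1) := Nat.sub_add_cancel (by nlinarith)
      have h4' : ((k * (m+1)).choose (m+1) : ℝ) * (m+1) = (k * (m+1)).choose m * (k * (m+1) - m) := by
        have h5' : ((k * (m+1) - m : ℕ) : ℝ) = k * (m+1) - m := by
          have : ((k * (m+1) - m + m : ℕ) : ℝ) = ((k * (m+1) : ℕ) : ℝ) := by rw [h5]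
          push_cast at this ⊢
          linarith
        rw [← h5']
        exact_mod_cast h4
      have hm : ((m:ℝ)+1) ≠ 0 := by positivity
      apply mul_left_cancel₀ hm
      push_cast at h3
      rw [h1] at h2 h3
      linear_combination (m+1:ℝ) * h2 + h3 - h4'
    | succ a iha =>
      rw [step, iha, show k * (m+1) + (a+1) = (k * (m+1) + a) + 1 by ring, Nat.choose_succ_succ]
      push_cast
      ring

lemma ee_one (hk : 2 ≤ k) (m : ℕ) : ee k 1 (m+1) = ((k * (m+1)).choose m : ℝ) := by
  rw [ee, WW, pow_one, mul_assoc, PowerSeries.coeff_succ_X_mul, coeff_TV hk,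
    show k * m + k = k * (m+1) by ring]

lemma ee_one' (hk : 2 ≤ k) (m : ℕ) : ee k 1 m = m * ee k 0 m := by
  have h := ee_rec hk 0 m
  simp only [Nat.cast_zero, zero_mul, add_zero, zero_add] at h
  have : (k : ℝ) ≠ 0 := by positivity
  exact (mul_left_cancel₀ this h).symm

lemma ee_zero (m : ℕ) : ee k 0 (m+1) = PowerSeries.coeff (m+1) (TT k) := by
  rw [TT_WW, map_add, ee]
  simp [PowerSeries.coeff_one]

/-- coefficients of `T^a V^2` -/
lemma coeff_TV2 (hk : 2 ≤ k) (m : ℕ) : ∀ a : ℕ,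
    PowerSeries.coeff m (TT k ^ a * VV k ^ 2) =
      ∑ j ∈ Finset.range (m+1), ((k:ℝ)-1) ^ j * ((k * m + a + 1).choose (m - j) : ℝ) := by
  have key : ∀ a : ℕ, TT k ^ a * VV k ^ 2 = TT k ^ (a+1) * VV k +
      PowerSeries.X * ((k : PowerSeries ℝ) * (TT k ^ (a+k) * VV k ^ 2)
        - TT k ^ (a+k) * VV k ^ 2) := by
    intro a
    have h := V_rel hk
    have h2 := TT_eq (k := k)
    rw [pow_succ, pow_add]
    linear_combination (TT k ^ a * VV k) * h +
      (TT k ^ a * VV k^2) * ((k : PowerSeries ℝ) - 1) * h2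
  induction m with
  | zero =>
    intro a
    have h1 := coeff0_TT (k := k)
    have h2 := coeff0_VV (k := k)
    simp only [PowerSeries.coeff_zero_eq_constantCoeff] at h1 h2
    simp [h1, h2]
  | succ m ih =>
    intro a
    rw [key, map_add, coeff_TV hk, PowerSeries.coeff_succ_X_mul, map_sub, coeff_nat_mul, ih,
      Finset.sum_range_succ' _ (m+1)]
    have e : k * m + (a + k) + 1 = k * (m+1) + a + 1 := by ring
    simp only [e, pow_zero, one_mul, Nat.sub_zero, Nat.add_sub_add_right, pow_succ]
    have : ∑ x ∈ Finset.range (m+1), ((k:ℝ)-1)^x * ((k:ℝ)-1) * ((k * (m+1) + a + 1).choose (m - x) : ℝ)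
      = ((k:ℝ)-1) * ∑ x ∈ Finset.range (m+1), ((k:ℝ)-1)^x * ((k * (m+1) + a + 1).choose (m - x) : ℝ) := by
      rw [Finset.mul_sum]
      refine Finset.sum_congr rfl fun _ _ => by ring
    rw [this, add_assoc (k * (m+1)) a 1]
    ring

lemma ee_two (hk : 2 ≤ k) (m : ℕ) : ((k:ℝ)-1) * ee k 2 (m+1) =
    k * (∑ j ∈ Finset.range (m+1), ((k:ℝ)-1) ^ j * ((k * (m+1)).choose (m - j) : ℝ)) - ee k 1 (m+1) := by
  have h : (k : PowerSeries ℝ) * (WW k * VV k ^ 2) - WW k * VV k ^ 2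
      = PowerSeries.X * ((k : PowerSeries ℝ) * (TT k ^ (k-1) * VV k ^ 2)) - WW k * VV k ^ 1 := by
    have hr := V_rel hk
    have hz : WW k = PowerSeries.X * TT k ^ (k-1) * TT k := by
      rw [pow_one_eq hk, WW, pow_zero_eq hk]; ring
    rw [hz]
    linear_combination (-PowerSeries.X * TT k ^ (k-1) * VV k) * hr
  have h' := congrArg (PowerSeries.coeff (m+1)) h
  simp only [map_sub, coeff_nat_mul, PowerSeries.coeff_succ_X_mul, coeff_TV2 hk] at h'
  have e : k * m + (k - 1) + 1 = k * (m+1) := by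
    have : k - 1 + 1 = k := Nat.sub_add_cancel (by omega)
    rw [add_assoc, this]; ring
  rw [e] at h'
  simp only [ee]
  linear_combination h'

end KTree

namespace KTree

/-- binomial weights -/
noncomputable def bb (q M l : ℕ) : ℝ :=
  (((q+1)*M).choose l : ℝ) * (q:ℝ) ^ ((q+1)*M - l)

lemma bb_nonneg (q M l : ℕ) : 0 ≤ bb q M l := by unfold bb; positivity

lemma bb_rec (q M l : ℕ) : ((l:ℝ)+1) * q * bb q M (l+1) = ((q+1)*M - l) * bb q M l := by
  unfold bb
  rcases lt_or_ge l ((q+1)*M) with h | h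
  · have h4 := Nat.choose_succ_right_eq ((q+1)*M) l
    have h5 : (((q+1)*M - l : ℕ) : ℝ) = (q+1)*M - l := by
      rw [Nat.cast_sub h.le]; push_cast; ring
    have h4' : (((q+1)*M).choose (l+1) : ℝ) * (l+1) = ((q+1)*M).choose l * ((q+1)*M - l) := by
      rw [← h5]; exact_mod_cast h4
    have h6 : (q+1)*M - l = ((q+1)*M - (l+1)) + 1 := by omega
    rw [h6, pow_succ]
    linear_combination (q:ℝ) * q ^ ((q+1)*M - (l+1)) * h4'
  · rw [Nat.choose_eq_zero_of_lt (Nat.lt_succ_of_le h)]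
    rcases h.lt_or_eq with h | h
    · rw [Nat.choose_eq_zero_of_lt h]; simp
    · have : ((q:ℝ)+1)*M = l := by exact_mod_cast h
      rw [this]; simp

lemma bb_sum (q M : ℕ) : ∑ l ∈ Finset.range ((q+1)*M+1), bb q M l = ((q:ℝ)+1) ^ ((q+1)*M) := by
  have := add_pow (1:ℝ) (q:ℝ) ((q+1)*M)
  rw [add_comm (q:ℝ) 1, this]
  refine Finset.sum_congr rfl fun l _ => ?_
  unfold bb; simp; ring

lemma bb_zero (q M l : ℕ) (h : (q+1)*M < l) : bb q M l = 0 := by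
  unfold bb; rw [Nat.choose_eq_zero_of_lt h]; simp

lemma bb_mean (q M : ℕ) : ∑ l ∈ Finset.range ((q+1)*M+1), ((l:ℝ) - M) * bb q M l = 0 := by
  have h1 : ∑ l ∈ Finset.range ((q+1)*M+1), ((l:ℝ)+1) * q * bb q M (l+1)
      = ∑ l ∈ Finset.range ((q+1)*M+1), (((q:ℝ)+1)*M - l) * bb q M l :=
    Finset.sum_congr rfl fun l _ => bb_rec q M l
  have h2 : ∑ l ∈ Finset.range ((q+1)*M+1), ((l:ℝ)+1) * q * bb q M (l+1)
      = ∑ l ∈ Finset.range ((q+1)*M+1), (l:ℝ) * q * bb q M l := by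
    have h3 := Finset.sum_range_succ' (fun l : ℕ => (l:ℝ) * q * bb q M l) ((q+1)*M+1)
    rw [Finset.sum_range_succ, bb_zero q M _ (Nat.lt_succ_self _)] at h3
    simp only [mul_zero, add_zero, Nat.cast_zero, zero_mul, Nat.cast_add, Nat.cast_one] at h3
    exact h3.symm
  rw [h2] at h1
  have h4 : ∑ l ∈ Finset.range ((q+1)*M+1), ((q:ℝ)+1) * (((l:ℝ) - M) * bb q M l) = 0 := by
    rw [← sub_eq_zero, ← Finset.sum_sub_distrib] at h1
    rw [← h1]
    refine Finset.sum_congr rfl fun l _ => by ring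
  rw [← Finset.mul_sum] at h4
  have : (q:ℝ)+1 ≠ 0 := by positivity
  exact (mul_eq_zero.mp h4).resolve_left this

lemma bb_comp1 (q M : ℕ) (hq : 1 ≤ q) (i : ℕ) (hi : i < M) : bb q M (M-1-i) ≤ bb q M (M+i) := by
  have hq' : (1:ℝ) ≤ q := by exact_mod_cast hq
  induction i with
  | zero =>
    obtain ⟨m, rfl⟩ := Nat.exists_eq_add_of_lt hi
    have h := bb_rec q (0+m+1) m
    have h0 := bb_nonneg q (0+m+1) m
    simp only [zero_add, Nat.add_sub_cancel, Nat.sub_zero, add_zero] at h h0 ⊢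
    push_cast at h
    have hp : 0 < ((m:ℝ)+1) * q := by positivity
    refine le_of_mul_le_mul_left ?_ hp
    rw [h]
    nlinarith
  | succ i ih =>
    have ih := ih (by omega)
    obtain ⟨m, rfl⟩ := Nat.exists_eq_add_of_lt hi
    set M := i + 1 + m + 1 with hM
    have e1 : M - 1 - i = m + 1 := by omega
    have e2 : M - 1 - (i+1) = m := by omega
    rw [e1] at ih
    rw [e2]
    have h1 := bb_rec q M m
    have h2 := bb_rec q M (M+i)
    have h0 := bb_nonneg q M m
    have h0' := bb_nonneg q M (m+1)
    have h0'' := bb_nonneg q M (M+i)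
    have hMr : (M:ℝ) = i + 1 + m + 1 := by rw [hM]; push_cast; ring
    rw [← add_assoc]
    generalize bb q M m = A at *
    generalize bb q M (m+1) = B at *
    generalize bb q M (M+i) = C at *
    generalize bb q M (M+i+1) = E at *
    rw [Nat.cast_add, hMr] at h2
    rw [hMr] at h1
    have hi0 : (0:ℝ) ≤ i := by positivity
    have hm0 : (0:ℝ) ≤ m := by positivity
    -- A * (qM+i+2) = (m+1) q B ≤ (m+1) q C ; (M+i+1) q E = (qM - i) C
    set x : ℝ := (q+1)*(i+1+m+1) - m with hx
    set y : ℝ := (q+1)*(i+1+m+1) - (i+1+m+1+i) with hy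
    have hxpos : 0 < x := by rw [hx]; nlinarith
    have hz : 0 < (((i:ℝ)+1+m+1+i)+1) * q := by positivity
    refine le_of_mul_le_mul_left ?_ (mul_pos hxpos hz)
    have t1 : x * A ≤ (m+1) * q * C := by
      rw [← h1]; exact mul_le_mul_of_nonneg_left ih (by positivity)
    have t2 : x * ((((i:ℝ)+1+m+1+i)+1) * q * E) = x * (y * C) := by rw [h2]
    have t3 : (((i:ℝ)+1+m+1+i)+1) * q * ((m+1) * q) ≤ x * y := by
      rw [hx, hy]
      have : ((q:ℝ)+1)*(i+1+m+1) - m = q*(i+1+m+1) + i + 2 := by ring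
      rw [this]
      have : ((q:ℝ)+1)*(i+1+m+1) - (i+1+m+1+i) = q*(i+1+m+1) - i := by ring
      rw [this]
      have h1q : 1 ≤ (q:ℝ)^2 := by nlinarith
      nlinarith [mul_nonneg (sub_nonneg.mpr h1q) (sq_nonneg ((i:ℝ)+1)), mul_nonneg hi0 hm0]
    calc x * ((((i:ℝ)+1+m+1+i)+1) * q) * A = ((((i:ℝ)+1+m+1+i)+1) * q) * (x * A) := by ring
      _ ≤ ((((i:ℝ)+1+m+1+i)+1) * q) * ((m+1) * q * C) := mul_le_mul_of_nonneg_left t1 hz.le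
      _ = ((((i:ℝ)+1+m+1+i)+1) * q * ((m+1) * q)) * C := by ring
      _ ≤ (x * y) * C := mul_le_mul_of_nonneg_right t3 h0''
      _ = _ := by linear_combination -t2

/-- lower partial sums -/
noncomputable def SS (q M : ℕ) : ℝ := ∑ l ∈ Finset.range M, bb q M l

lemma SS_upper (q M : ℕ) (hq : 1 ≤ q) : 2 * SS q M ≤ ((q:ℝ)+1) ^ ((q+1)*M) := by
  rw [← bb_sum, two_mul]
  have hM : (q+1)*M+1 = M + (M + ((q-1)*M+1)) := by
    obtain ⟨r, rfl⟩ := Nat.exists_eq_add_of_le hq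
    rw [Nat.add_sub_cancel_left]; ring
  rw [hM, Finset.sum_range_add, Finset.sum_range_add]
  have h1 : SS q M ≤ ∑ x ∈ Finset.range M, bb q M (M+x) := by
    rw [SS, ← Finset.sum_range_reflect]
    exact Finset.sum_le_sum fun i hi => bb_comp1 q M hq i (Finset.mem_range.mp hi)
  have h2 : 0 ≤ ∑ x ∈ Finset.range ((q-1)*M+1), bb q M (M + (M + x)) :=
    Finset.sum_nonneg fun _ _ => bb_nonneg _ _ _
  have h3 : SS q M = ∑ x ∈ Finset.range M, bb q M x := rfl
  linarith

/-- reflected weights -/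
noncomputable def vv (q M i : ℕ) : ℝ := if i ≤ M then bb q M (M-i) else 0

lemma vv_nonneg (q M i : ℕ) : 0 ≤ vv q M i := by
  unfold vv; split_ifs
  · exact bb_nonneg _ _ _
  · exact le_rfl

lemma vv_rec (q M i : ℕ) : ((q:ℝ)*M+i+1) * vv q M (i+1) = ((M:ℝ)-i) * q * vv q M i := by
  unfold vv
  rcases lt_trichotomy i M with h | h | h
  · obtain ⟨m, rfl⟩ := Nat.exists_eq_add_of_lt h
    rw [if_pos (by omega), if_pos (by omega), show i + m + 1 - (i+1) = m by omega,
      show i + m + 1 - i = m + 1 by omega]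
    have := bb_rec q (i+m+1) m
    push_cast at this ⊢
    linear_combination -this
  · subst h; simp
  · rw [if_neg (by omega), if_neg (by omega)]; simp

lemma uu_rec (q M i : ℕ) : ((M:ℝ)+i+1) * q * bb q M (M+i+1) = ((q:ℝ)*M-i) * bb q M (M+i) := by
  have := bb_rec q M (M+i)
  push_cast at this
  linear_combination this

lemma cross (q M i : ℕ) :
    (((M:ℝ)+i+1) * q * (((q:ℝ)*M+i+1))) * (bb q M (M+i+1) - vv q M (i+1)) =
    (((q:ℝ)*M-i) * ((q:ℝ)*M+i+1)) * (bb q M (M+i) - vv q M i) +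
     ((q:ℝ)-1) * (((q:ℝ)+1)*(i*(i+1)) - q*M) * vv q M i := by
  have h1 := vv_rec q M i
  have h2 := uu_rec q M i
  linear_combination ((q:ℝ)*M+i+1) * h2 - (((M:ℝ)+i+1) * q) * h1

lemma sgn_neg (q M : ℕ) (hq : 1 ≤ q) (i : ℕ) :
    (∀ l < i, (q+1)*(l*(l+1)) ≤ q*M) → bb q M (M+i) - vv q M i ≤ 0 := by
  induction i with
  | zero => intro _; simp [vv]
  | succ i ih =>
    intro h
    have ih := ih (fun l hl => h l (by omega))
    have hi := h i (by omega)
    have hq' : (1:ℝ) ≤ q := by exact_mod_cast hq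
    have hir : ((q:ℝ)+1)*(i*(i+1)) ≤ q*M := by exact_mod_cast hi
    rcases lt_or_ge i M with hM | hM
    · have hc := cross q M i
      have hiM : (i:ℝ) + 1 ≤ M := by exact_mod_cast hM
      have hi0 : (0:ℝ) ≤ i := by positivity
      have p1 : 0 < ((M:ℝ)+i+1) * q * (((q:ℝ)*M+i+1)) := by positivity
      have p2 : 0 ≤ ((q:ℝ)*M-i) * ((q:ℝ)*M+i+1) := by
        apply mul_nonneg
        · nlinarith
        · positivity
      have p3 : 0 ≤ ((q:ℝ)-1) * (q*M - ((q:ℝ)+1)*(i*(i+1))) * vv q M i :=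
        mul_nonneg (mul_nonneg (by linarith) (by linarith)) (vv_nonneg _ _ _)
      rw [← add_assoc]
      by_contra hcon
      push Not at hcon
      have := mul_pos p1 hcon
      have := mul_nonneg p2 (neg_nonneg.mpr ih)
      linarith
    · -- i ≥ M forces M = 0
      have : M = 0 := by
        by_contra h0
        have : M * (M+1) ≤ i * (i+1) := Nat.mul_le_mul hM (by omega)
        have h3 := (Nat.mul_le_mul_left (q+1) this).trans hi
        have : 1 ≤ M := by omega
        nlinarith [Nat.zero_le (q*(M*M))]
      subst this
      have : bb q 0 (0 + (i+1)) = 0 := bb_zero q 0 _ (by simp)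
      rw [this]
      linarith [vv_nonneg q 0 (i+1)]

lemma sgn_pos (q M : ℕ) (hq : 1 ≤ q) (i : ℕ) (h : q*M ≤ (q+1)*(i*(i+1)))
    (hi : 0 ≤ bb q M (M+i) - vv q M i) : 0 ≤ bb q M (M+(i+1)) - vv q M (i+1) := by
  have hq' : (1:ℝ) ≤ q := by exact_mod_cast hq
  have hir : (q*M:ℝ) ≤ ((q:ℝ)+1)*(i*(i+1)) := by exact_mod_cast h
  rcases lt_or_ge i M with hM | hM
  · have hc := cross q M i
    have hiM : (i:ℝ) + 1 ≤ M := by exact_mod_cast hM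
    have hi0 : (0:ℝ) ≤ i := by positivity
    have p1 : 0 < ((M:ℝ)+i+1) * q * (((q:ℝ)*M+i+1)) := by positivity
    have p2 : 0 ≤ ((q:ℝ)*M-i) * ((q:ℝ)*M+i+1) := by
      apply mul_nonneg
      · nlinarith
      · positivity
    have p3 : 0 ≤ ((q:ℝ)-1) * (((q:ℝ)+1)*(i*(i+1)) - q*M) * vv q M i :=
      mul_nonneg (mul_nonneg (by linarith) (by linarith)) (vv_nonneg _ _ _)
    rw [← add_assoc]
    by_contra hcon
    push Not at hcon
    have := mul_pos p1 (neg_pos.mpr hcon)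
    have := mul_nonneg p2 hi
    linarith
  · have : vv q M (i+1) = 0 := by unfold vv; rw [if_neg (by omega)]
    rw [this, sub_zero]
    exact bb_nonneg _ _ _

lemma crossing (q M : ℕ) (hq : 1 ≤ q) : ∃ i0 : ℕ, 1 ≤ i0 ∧
    ∀ i : ℕ, 0 ≤ ((i:ℝ) - i0) * (bb q M (M+i) - vv q M i) := by
  classical
  have hex : ∃ i : ℕ, 1 ≤ i ∧ q*M ≤ (q+1)*(i*(i+1)) ∧ 0 ≤ bb q M (M+i) - vv q M i := by
    refine ⟨M+1, by omega, by nlinarith [Nat.zero_le (q*M), Nat.zero_le M, Nat.zero_le (q*M*M)], ?_⟩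
    have : vv q M (M+1) = 0 := by unfold vv; rw [if_neg (by omega)]
    rw [this, sub_zero]; exact bb_nonneg _ _ _
  refine ⟨Nat.find hex, (Nat.find_spec hex).1, fun i => ?_⟩
  rcases lt_or_ge i (Nat.find hex) with h | h
  · have hlt : (i:ℝ) < Nat.find hex := by exact_mod_cast h
    have hle : bb q M (M+i) - vv q M i ≤ 0 := by
      have hm := Nat.find_min hex h
      by_cases h2 : q*M ≤ (q+1)*(i*(i+1))
      · by_cases h1 : 1 ≤ i
        · by_contra hcon
          exact hm ⟨h1, h2, (not_le.mp hcon).le⟩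
        · have : i = 0 := by omega
          subst this
          simp [vv]
      · apply sgn_neg q M hq i
        intro l hl
        have : l * (l+1) ≤ i*(i+1) := Nat.mul_le_mul hl.le (by omega)
        have := Nat.mul_le_mul_left (q+1) this
        omega
    nlinarith
  · have hge : ((Nat.find hex : ℕ):ℝ) ≤ i := by exact_mod_cast h
    have : q*M ≤ (q+1)*(i*(i+1)) ∧ 0 ≤ bb q M (M+i) - vv q M i := by
      induction i, h using Nat.le_induction with
      | base => exact (Nat.find_spec hex).2
      | succ n hn ih =>
        have ih := ih (by exact_mod_cast hn)
        refine ⟨ih.1.trans (Nat.mul_le_mul_left _ (Nat.mul_le_mul (by omega) (by omega))), ?_⟩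
        exact sgn_pos q M hq n ih.1 ih.2
    exact mul_nonneg (by linarith) this.2

lemma vv_sum (q M : ℕ) (hq : 1 ≤ q) (g : ℕ → ℝ) :
    ∑ i ∈ Finset.range (q*M+1), g i * vv q M i = ∑ i ∈ Finset.range (M+1), g i * bb q M (M-i) := by
  have hsub : Finset.range (M+1) ⊆ Finset.range (q*M+1) := by
    apply Finset.range_subset_range.mpr
    nlinarith
  rw [← Finset.sum_subset hsub]
  · refine Finset.sum_congr rfl fun i hi => ?_
    rw [Finset.mem_range] at hi
    unfold vv; rw [if_pos (by omega)]
  · intro i _ hi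
    rw [Finset.mem_range] at hi
    unfold vv; rw [if_neg (by omega), mul_zero]

lemma SS_lower (q M : ℕ) (hq : 1 ≤ q) :
    ((q:ℝ)+1) ^ ((q+1)*M) - bb q M M ≤ 2 * SS q M := by
  obtain ⟨i0, hi0, hc⟩ := crossing q M hq
  have hN : (q+1)*M+1 = M + (q*M+1) := by ring
  have hsum := bb_sum q M
  have hmean := bb_mean q M
  rw [hN, Finset.sum_range_add] at hsum hmean
  have hv1 := vv_sum q M hq (fun _ => 1)
  have hv2 := vv_sum q M hq (fun i => (i:ℝ))
  simp only [one_mul] at hv1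
  have hr1 : ∑ i ∈ Finset.range (M+1), bb q M (M-i) = SS q M + bb q M M := by
    have := Finset.sum_range_reflect (fun l => bb q M l) (M+1)
    simp only [Nat.add_sub_cancel] at this
    rw [this, Finset.sum_range_succ, SS]
  have hr2 : ∑ i ∈ Finset.range (M+1), (i:ℝ) * bb q M (M-i)
      = - ∑ l ∈ Finset.range M, ((l:ℝ) - M) * bb q M l := by
    have := Finset.sum_range_reflect (fun l => ((M:ℝ) - l) * bb q M l) (M+1)
    simp only [Nat.add_sub_cancel] at this
    rw [Finset.sum_range_succ (fun l : ℕ => ((M:ℝ) - l) * bb q M l) M, sub_self, zero_mul, add_zero] at this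
    have hneg : - ∑ l ∈ Finset.range M, ((l:ℝ) - M) * bb q M l
        = ∑ l ∈ Finset.range M, ((M:ℝ) - l) * bb q M l := by
      rw [← Finset.sum_neg_distrib]
      exact Finset.sum_congr rfl fun l _ => by ring
    rw [hneg, ← this]
    refine Finset.sum_congr rfl fun i hi => ?_
    rw [Finset.mem_range] at hi
    rw [Nat.cast_sub (by omega)]; ring
  have hnn : 0 ≤ ∑ i ∈ Finset.range (q*M+1), ((i:ℝ) - i0) * (bb q M (M+i) - vv q M i) :=
    Finset.sum_nonneg fun i _ => hc i
  have hexp : ∑ i ∈ Finset.range (q*M+1), ((i:ℝ) - i0) * (bb q M (M+i) - vv q M i) =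
      (∑ i ∈ Finset.range (q*M+1), (((M+i:ℕ):ℝ) - M) * bb q M (M+i)
       - ∑ i ∈ Finset.range (q*M+1), (i:ℝ) * vv q M i)
      - i0 * (∑ i ∈ Finset.range (q*M+1), bb q M (M+i) - ∑ i ∈ Finset.range (q*M+1), vv q M i) := by
    rw [← Finset.sum_sub_distrib, ← Finset.sum_sub_distrib, Finset.mul_sum, ← Finset.sum_sub_distrib]
    refine Finset.sum_congr rfl fun i _ => ?_
    push_cast; ring
  rw [hexp, hv2, hr2, hv1, hr1] at hnn
  have h1 : (0:ℝ) < i0 := by exact_mod_cast hi0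
  have h2 : ∑ i ∈ Finset.range (q*M+1), bb q M (M+i) - (SS q M + bb q M M) ≤ 0 := by
    by_contra hcon
    have := mul_pos h1 (not_le.mp hcon)
    linarith
  have h3 : SS q M = ∑ x ∈ Finset.range M, bb q M x := rfl
  linarith

end KTree

namespace KTree

open Stirling in
lemma stirling_upper (n : ℕ) : stirlingSeq (n+1) ≤ √Real.pi * Real.exp (1 / (2 * ((n:ℝ)+1))) := by
  have hmono : Monotone (fun n : ℕ => Real.log (stirlingSeq (n+1)) - 1 / (2 * ((n:ℝ)+1))) := by
    apply monotone_nat_of_le_succ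
    intro n
    have h := log_stirlingSeq_sdiff_le (n+1)
    push_cast at h
    have h2 : 1 / (12 * ((n:ℝ)+1) * ((n:ℝ)+1+1)) ≤ 1 / (2 * ((n:ℝ)+1)) - 1 / (2 * (((n+1:ℕ):ℝ)+1)) := by
      have : 1 / (2 * ((n:ℝ)+1)) - 1 / (2 * (((n+1:ℕ):ℝ)+1)) = 1 / (2 * ((n:ℝ)+1) * ((n:ℝ)+2)) := by
        push_cast; field_simp; ring
      rw [this]
      apply one_div_le_one_div_of_le (by positivity)
      have : (0:ℝ) ≤ n := by positivity
      nlinarith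
    linarith
  have hlim : Filter.Tendsto (fun n : ℕ => Real.log (stirlingSeq (n+1)) - 1 / (2 * ((n:ℝ)+1)))
      Filter.atTop (nhds (Real.log √Real.pi - 0)) := by
    apply Filter.Tendsto.sub
    · have h1 := (Filter.tendsto_add_atTop_iff_nat 1).mpr tendsto_stirlingSeq_sqrt_pi
      exact h1.log (by positivity)
    · have h := (tendsto_one_div_add_atTop_nhds_zero_nat (𝕜 := ℝ)).const_mul (1/2)
      rw [mul_zero] at h
      refine h.congr fun n => ?_
      field_simp
  have h := hmono.ge_of_tendsto hlim n
  rw [sub_zero] at h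
  have hp := stirlingSeq'_pos n
  rw [← Real.exp_log hp, ← Real.exp_log (show 0 < √Real.pi by positivity), ← Real.exp_add]
  apply Real.exp_le_exp.mpr
  linarith

open Stirling in
lemma stirling_upper' (n : ℕ) (hn : 1 ≤ n) : stirlingSeq n ≤ √Real.pi * Real.exp (1 / (2 * (n:ℝ))) := by
  obtain ⟨m, rfl⟩ := Nat.exists_eq_add_of_le' hn
  have := stirling_upper m
  push_cast
  exact this

open Stirling in
lemma factorial_eq (n : ℕ) (hn : 1 ≤ n) :
    (n.factorial : ℝ) = stirlingSeq n * (√(2 * n) * (n / Real.exp 1) ^ n) := by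
  unfold stirlingSeq
  have : √(2 * (n:ℝ)) * (n / Real.exp 1) ^ n ≠ 0 := by positivity
  field_simp

/-- inverse of the central binomial probability -/
noncomputable def bet (q M : ℕ) : ℝ := ((q:ℝ)+1) ^ ((q+1)*M) / bb q M M

lemma bb_fact (q M : ℕ) : bb q M M * (M.factorial * (q*M).factorial) =
    ((q+1)*M).factorial * (q:ℝ) ^ (q*M) := by
  have h := Nat.add_choose_mul_factorial_mul_factorial (q*M) M
  have e : q*M + M = (q+1)*M := by ring
  rw [e] at h
  unfold bb
  have e2 : (q+1)*M - M = q*M := by rw [← e]; omega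
  rw [e2]
  have h' : (((q+1)*M).choose M : ℝ) * (q*M).factorial * M.factorial = ((q+1)*M).factorial := by
    exact_mod_cast h
  linear_combination (q:ℝ)^(q*M) * h'

lemma bb_pos (q M : ℕ) (hq : 1 ≤ q) : 0 < bb q M M := by
  unfold bb
  have : 0 < ((q+1)*M).choose M := Nat.choose_pos (by nlinarith)
  positivity

open Stirling in
lemma bet_eq (q M : ℕ) (hq : 1 ≤ q) (hM : 1 ≤ M) :
    bet q M = stirlingSeq M * stirlingSeq (q*M) / stirlingSeq ((q+1)*M) * (√(2*q/(q+1)) * √M) := by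
  have hqM : 1 ≤ q*M := Nat.mul_pos hq hM
  have hkM : 1 ≤ (q+1)*M := Nat.mul_pos (by omega) hM
  have hB := bb_pos q M hq
  have hf := bb_fact q M
  rw [factorial_eq M hM, factorial_eq _ hqM, factorial_eq _ hkM] at hf
  have s1 : 0 < stirlingSeq ((q+1)*M) := lt_of_lt_of_le (by positivity) (sqrt_pi_le_stirlingSeq (by omega))
  rw [bet, div_eq_iff hB.ne', div_mul_eq_mul_div, div_mul_eq_mul_div, eq_div_iff s1.ne']
  push_cast at hf
  have hpow : ((M:ℝ) / Real.exp 1) ^ M * ((q * M : ℝ) / Real.exp 1) ^ (q*M) * ((q:ℝ)+1)^((q+1)*M)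
      = (((q:ℝ)+1) * M / Real.exp 1) ^ ((q+1)*M) * (q:ℝ)^(q*M) := by
    have e : (q+1)*M = q*M + M := by ring
    rw [e]
    simp only [div_pow, mul_pow, pow_add]
    field_simp
  have hs : √(2 * (M:ℝ)) * √(2 * (q * M)) = √(2*q/(q+1)) * √M * √(2 * (((q:ℝ)+1)*M)) := by
    rw [← Real.sqrt_mul (by positivity), ← Real.sqrt_mul (by positivity), ← Real.sqrt_mul (by positivity)]
    congr 1
    field_simp
  have hne : √(2 * (((q:ℝ)+1)*M)) * (((q:ℝ)+1) * M / Real.exp 1) ^ ((q+1)*M) * (q:ℝ)^(q*M) ≠ 0 := by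
    have : (0:ℝ) < q := by exact_mod_cast hq
    have : (0:ℝ) < M := by exact_mod_cast hM
    positivity
  apply mul_right_cancel₀ hne
  generalize stirlingSeq M = a at *
  generalize stirlingSeq (q*M) = b at *
  generalize stirlingSeq ((q+1)*M) = c at *
  generalize bb q M M = B at *
  generalize √(2 * (M:ℝ)) = x1 at *
  generalize √(2 * (q * M) : ℝ) = x2 at *
  generalize √(2 * (((q:ℝ)+1)*M)) = x3 at *
  generalize √(2*q/(q+1) : ℝ) * √(M:ℝ) = y at *
  generalize ((M:ℝ) / Real.exp 1) ^ M = p1 at *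
  generalize ((q * M : ℝ) / Real.exp 1) ^ (q*M) = p2 at *
  generalize (((q:ℝ)+1) * M / Real.exp 1) ^ ((q+1)*M) = p3 at *
  generalize ((q:ℝ)+1)^((q+1)*M) = p4 at *
  generalize (q:ℝ)^(q*M) = p5 at *
  -- hf : B * (a*(x1*p1) * (b*(x2*p2))) = c*(x3*p3)*p5 ; hpow : p1*p2*p4 = p3*p5
  linear_combination (-p4) * hf + (B * a * b * x1 * x2) * hpow + (B * a * b * p3 * p5) * hs

open Stirling in
lemma bet_bound (q M : ℕ) (hq : 1 ≤ q) (hM : 1 ≤ M) :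
    |bet q M - √Real.pi * √(2*q/(q+1)) * √M| ≤ 2 * √Real.pi * √(2*q/(q+1)) := by
  have hqM : 1 ≤ q*M := Nat.mul_pos hq hM
  have hkM : 1 ≤ (q+1)*M := Nat.mul_pos (by omega) hM
  have hMr : (1:ℝ) ≤ M := by exact_mod_cast hM
  have hqr : (1:ℝ) ≤ q := by exact_mod_cast hq
  rw [bet_eq q M hq hM]
  have l1 := sqrt_pi_le_stirlingSeq (n := M) (by omega)
  have l2 := sqrt_pi_le_stirlingSeq (n := q*M) (by omega)
  have l3 := sqrt_pi_le_stirlingSeq (n := (q+1)*M) (by omega)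
  have u1 := stirling_upper' M hM
  have u2 := stirling_upper' _ hqM
  have u3 := stirling_upper' _ hkM
  have hpi : 0 < √Real.pi := by positivity
  set e1 := Real.exp (1/(2*(M:ℝ))) with he1
  have m2 : Real.exp (1 / (2 * ((q*M:ℕ):ℝ))) ≤ e1 := by
    apply Real.exp_le_exp.mpr
    apply one_div_le_one_div_of_le (by positivity)
    push_cast; nlinarith
  have m3 : Real.exp (1 / (2 * (((q+1)*M:ℕ):ℝ))) ≤ e1 := by
    apply Real.exp_le_exp.mpr
    apply one_div_le_one_div_of_le (by positivity)
    push_cast; nlinarith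
  have e1p : 0 < e1 := Real.exp_pos _
  have e1ge : 1 ≤ e1 := Real.one_le_exp (by positivity)
  have u2' : stirlingSeq (q*M) ≤ √Real.pi * e1 := u2.trans (mul_le_mul_of_nonneg_left m2 hpi.le)
  have u3' : stirlingSeq ((q+1)*M) ≤ √Real.pi * e1 := u3.trans (mul_le_mul_of_nonneg_left m3 hpi.le)
  have e12 : e1 * e1 ≤ 1 + 2 / M := by
    rw [he1, ← Real.exp_add]
    have : 1 / (2*(M:ℝ)) + 1 / (2*(M:ℝ)) = 1 / M := by field_simp; norm_num
    rw [this]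
    have h := Real.abs_exp_sub_one_le (x := 1/(M:ℝ)) (by
      rw [abs_of_nonneg (by positivity)]; exact (div_le_one (by linarith)).mpr hMr)
    rw [abs_of_nonneg (by positivity : (0:ℝ) ≤ 1/(M:ℝ))] at h
    have := (abs_le.mp h).2
    have e : 2 * (1/(M:ℝ)) = 2 / M := by ring
    linarith
  set a := stirlingSeq M
  set b := stirlingSeq (q*M)
  set c := stirlingSeq ((q+1)*M)
  have cp : 0 < c := lt_of_lt_of_le hpi l3
  have hup : a * b / c ≤ √Real.pi * (1 + 2/M) := by
    rw [div_le_iff₀ cp]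
    calc a * b ≤ (√Real.pi * e1) * (√Real.pi * e1) := mul_le_mul u1 u2' (by linarith) (by positivity)
      _ = √Real.pi * (e1 * e1) * √Real.pi := by ring
      _ ≤ √Real.pi * (1+2/M) * c := by gcongr
  have hlo : √Real.pi * (1 - 2/M) ≤ a * b / c := by
    rw [le_div_iff₀ cp]
    have hx : (1 - 2/(M:ℝ)) * e1 ≤ 1 := by
      have : (0:ℝ) ≤ 2/M := by positivity
      rcases le_or_gt (1 - 2/(M:ℝ)) 0 with h | h
      · nlinarith
      · have : (1 - 2/(M:ℝ)) * (e1 * e1) ≤ (1 - 2/(M:ℝ)) * (1 + 2/M) := mul_le_mul_of_nonneg_left e12 h.le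
        nlinarith
    rcases le_or_gt (1 - 2/(M:ℝ)) 0 with h | h
    · have h1 : √Real.pi * (1 - 2/(M:ℝ)) * c ≤ 0 :=
        mul_nonpos_of_nonpos_of_nonneg (mul_nonpos_of_nonneg_of_nonpos hpi.le h) cp.le
      have h2 : 0 ≤ a * b := mul_nonneg (by linarith) (by linarith)
      linarith
    · calc √Real.pi * (1 - 2/(M:ℝ)) * c ≤ √Real.pi * (1 - 2/(M:ℝ)) * (√Real.pi * e1) := by gcongr
        _ = √Real.pi * √Real.pi * ((1 - 2/(M:ℝ)) * e1) := by ring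
        _ ≤ √Real.pi * √Real.pi * 1 := by gcongr
        _ ≤ a * b := by rw [mul_one]; exact mul_le_mul l1 l2 hpi.le (by linarith)
  have habs : |a * b / c - √Real.pi| ≤ √Real.pi * (2/M) := by
    rw [abs_le]; constructor <;> linarith
  have e : a * b / c * (√(2*q/(q+1)) * √M) - √Real.pi * √(2*q/(q+1)) * √M =
      (a * b / c - √Real.pi) * (√(2*q/(q+1)) * √M) := by ring
  rw [e, abs_mul, abs_of_nonneg (by positivity : 0 ≤ √(2*q/(q+1) : ℝ) * √(M:ℝ))]
  have hsq : √(M:ℝ) ≤ M := by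
    rw [Real.sqrt_le_left (by linarith)]; nlinarith
  calc |a * b / c - √Real.pi| * (√(2*q/(q+1)) * √M) ≤ (√Real.pi * (2/M)) * (√(2*q/(q+1)) * M) := by gcongr
    _ = 2 * √Real.pi * √(2*q/(q+1)) := by field_simp

end KTree

namespace KTree

lemma dsum_eq (q m : ℕ) :
    (∑ j ∈ Finset.range (m+1), (q:ℝ) ^ j * (((q+1) * (m+1)).choose (m - j) : ℝ)) * (q:ℝ)^(q*(m+1)+1)
      = SS q (m+1) := by
  rw [SS, ← Finset.sum_range_reflect, Finset.sum_mul]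
  refine Finset.sum_congr rfl fun j hj => ?_
  rw [Finset.mem_range] at hj
  have e : (q+1)*(m+1) - j = (m-j) + (q*(m+1)+1) := by
    have : (q+1)*(m+1) = q*(m+1) + (m+1) := by ring
    omega
  rw [Nat.add_sub_cancel, bb, e, pow_add, show m - (m-j) = j by omega]
  ring

lemma cB (q m : ℕ) (hq : 1 ≤ q) : bb q (m+1) (m+1) =
    ((q:ℝ)*(m+1)+1) * ee (q+1) 0 (m+1) * (q:ℝ)^(q*(m+1)) := by
  have h1 := ee_one (k := q+1) (by omega) m
  have h2 := ee_one' (k := q+1) (by omega) (m+1)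
  rw [h1] at h2
  have h := bb_rec q (m+1) m
  have hb : bb q (m+1) m = ((((q+1)*(m+1)).choose m : ℕ) : ℝ) * ((q:ℝ)^(q*(m+1)) * q) := by
    have e : (q+1)*(m+1) - m = q*(m+1)+1 := by
      have : (q+1)*(m+1) = q*(m+1) + (m+1) := by ring
      omega
    rw [bb, e, pow_succ]
  rw [hb, h2] at h
  have hne : ((m:ℝ)+1) * q ≠ 0 := by positivity
  apply mul_left_cancel₀ hne
  rw [h]
  push_cast
  ring

lemma ee0_pos (q m : ℕ) (hq : 1 ≤ q) : 0 < ee (q+1) 0 (m+1) := by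
  have h := cB q m hq
  have hp := bb_pos q (m+1) hq
  rw [h] at hp
  by_contra hcon
  have : ((q:ℝ)*(m+1)+1) * ee (q+1) 0 (m+1) * (q:ℝ)^(q*(m+1)) ≤ 0 := by
    apply mul_nonpos_of_nonpos_of_nonneg
    · apply mul_nonpos_of_nonneg_of_nonpos (by positivity) (not_lt.mp hcon)
    · positivity
  linarith

/-- mean -/
noncomputable def av (q M : ℕ) : ℝ := ee (q+1) 2 M / ee (q+1) 0 M

lemma av_formula (q M : ℕ) (hq : 1 ≤ q) (hM : 1 ≤ M) : ∃ θ : ℝ, 0 ≤ θ ∧ θ ≤ 1 ∧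
    q * av q M = ((q:ℝ)+1) * (q*M+1) * (bet q M - θ) / (2*q) - M := by
  obtain ⟨m, rfl⟩ := Nat.exists_eq_add_of_le' hM
  have hc := ee0_pos q m hq
  have hB := cB q m hq
  have hBp := bb_pos q (m+1) hq
  have hg := ee_two (k := q+1) (by omega) m
  have h1 := ee_one' (k := q+1) (by omega) (m+1)
  have hd := dsum_eq q m
  have hu := SS_upper q (m+1) hq
  have hl := SS_lower q (m+1) hq
  have hq0 : (0:ℝ) < q := by exact_mod_cast hq
  have hqp : 0 < (q:ℝ)^(q*(m+1)) := by positivity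
  push_cast at hg
  rw [add_sub_cancel_right] at hg
  refine ⟨bet q (m+1) - 2 * SS q (m+1) / bb q (m+1) (m+1), ?_, ?_, ?_⟩
  · rw [bet, ← sub_div]
    apply div_nonneg _ hBp.le
    linarith
  · rw [bet, ← sub_div, div_le_one hBp]
    linarith
  · rw [sub_sub_cancel, av, ← mul_div_assoc, hg, h1, ← hd, hB]
    push_cast
    generalize (∑ j ∈ Finset.range (m+1), (q:ℝ) ^ j * (((q+1) * (m+1)).choose (m - j) : ℝ)) = d
    rw [pow_succ]
    field_simp

open Asymptotics Filter

lemma pow_bigO (i j : ℕ) (h : i ≤ j) :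
    (fun M : ℕ => √(M:ℝ) ^ i) =O[atTop] (fun M : ℕ => √(M:ℝ) ^ j) := by
  apply IsBigO.of_bound 1
  filter_upwards [eventually_ge_atTop 1] with M hM
  have : (1:ℝ) ≤ √(M:ℝ) := Real.one_le_sqrt.mpr (by exact_mod_cast hM)
  rw [one_mul, Real.norm_of_nonneg (by positivity), Real.norm_of_nonneg (by positivity)]
  exact pow_le_pow_right₀ this h

/-- limit constant -/
noncomputable def alp (q : ℕ) : ℝ := ((q:ℝ)+1) / (2*q) * (√Real.pi * √(2*q/(q+1)))

lemma alp_sq (q : ℕ) (hq : 1 ≤ q) : alp q ^ 2 = Real.pi * (((q:ℝ)+1)/(2*q)) := by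
  have hq0 : (0:ℝ) < q := by exact_mod_cast hq
  unfold alp
  rw [mul_pow, mul_pow, Real.sq_sqrt Real.pi_pos.le, Real.sq_sqrt (by positivity)]
  field_simp
  try ring


lemma av_bigO (q : ℕ) (hq : 1 ≤ q) :
    (fun M : ℕ => av q M - alp q * √(M:ℝ) ^ 3) =O[atTop] (fun M : ℕ => √(M:ℝ) ^ 2) := by
  have hq0 : (0:ℝ) < q := by exact_mod_cast hq
  set s : ℝ := √Real.pi * √(2*q/(q+1)) with hs
  have hb : (fun M : ℕ => bet q M - s * √(M:ℝ)) =O[atTop] (fun M : ℕ => √(M:ℝ) ^ 0) := by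
    apply IsBigO.of_bound (2 * s)
    filter_upwards [eventually_ge_atTop 1] with M hM
    have := bet_bound q M hq hM
    rw [Real.norm_eq_abs, pow_zero, norm_one, mul_one, hs]
    rw [← mul_assoc]
    exact this
  choose! θ hθ0 hθ1 hθ using fun M hM => av_formula q M hq hM
  have ht : θ =O[atTop] (fun M : ℕ => √(M:ℝ) ^ 0) := by
    apply IsBigO.of_bound 1
    filter_upwards [eventually_ge_atTop 1] with M hM
    rw [Real.norm_of_nonneg (hθ0 M hM)]
    simpa using hθ1 M hM
  have e : (fun M : ℕ => av q M - alp q * √(M:ℝ) ^ 3) =ᶠ[atTop]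
      fun M : ℕ => (((q:ℝ)+1)/(2*q)) * (√(M:ℝ)^2 * (bet q M - s * √(M:ℝ)))
        + ((-((q:ℝ)+1)/(2*q)) * (√(M:ℝ)^2 * θ M)
        + ((((q:ℝ)+1)/(2*q^2)) * (√(M:ℝ)^0 * (bet q M - s * √(M:ℝ)))
        + ((((q:ℝ)+1)/(2*q^2)*s) * √(M:ℝ)^1 + ((-((q:ℝ)+1)/(2*q^2)) * (√(M:ℝ)^0 * θ M)
        + (-1/q) * √(M:ℝ)^2)))) := by
    filter_upwards [eventually_ge_atTop 1] with M hM
    have h := hθ M hM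
    have hav : av q M = (((q:ℝ)+1) * (q*M+1) * (bet q M - θ M) / (2*q) - M) / q := by
      rw [← h]; field_simp
    have hx : (M:ℝ) = √(M:ℝ)^2 := (Real.sq_sqrt (Nat.cast_nonneg M)).symm
    rw [hav, alp, ← hs]
    generalize √(M:ℝ) = x at *
    rw [hx]
    field_simp
    ring
  have m1 : (fun M : ℕ => √(M:ℝ)^2 * (bet q M - s * √(M:ℝ))) =O[atTop] (fun M : ℕ => √(M:ℝ) ^ 2) := by
    simpa only [pow_zero, mul_one] using (isBigO_refl (fun M : ℕ => √(M:ℝ) ^ 2) atTop).mul hb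
  have m2 : (fun M : ℕ => √(M:ℝ)^2 * θ M) =O[atTop] (fun M : ℕ => √(M:ℝ) ^ 2) := by
    simpa only [pow_zero, mul_one] using (isBigO_refl (fun M : ℕ => √(M:ℝ) ^ 2) atTop).mul ht
  have m3 : (fun M : ℕ => √(M:ℝ)^0 * (bet q M - s * √(M:ℝ))) =O[atTop] (fun M : ℕ => √(M:ℝ) ^ 2) := by
    simpa only [pow_zero, one_mul] using hb.trans (pow_bigO 0 2 (by norm_num))
  have m4 : (fun M : ℕ => √(M:ℝ)^0 * θ M) =O[atTop] (fun M : ℕ => √(M:ℝ) ^ 2) := by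
    simpa only [pow_zero, one_mul] using ht.trans (pow_bigO 0 2 (by norm_num))
  refine IsBigO.congr' ?_ e.symm EventuallyEq.rfl
  exact (m1.const_mul_left _).add ((m2.const_mul_left _).add ((m3.const_mul_left _).add
    (((pow_bigO 1 2 (by norm_num)).const_mul_left _).add ((m4.const_mul_left _).add
      ((isBigO_refl _ _).const_mul_left _)))))

/-- second moment -/
noncomputable def qv (q M : ℕ) : ℝ := PowerSeries.coeff M (QQ (q+1)) / ee (q+1) 0 M


end KTree

namespace KTree

open Asymptotics Filter

lemma av_bigO3 (q : ℕ) (hq : 1 ≤ q) :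
    (fun M : ℕ => av q M) =O[atTop] (fun M : ℕ => √(M:ℝ) ^ 3) := by
  have h1 := (av_bigO q hq).trans (pow_bigO 2 3 (by norm_num))
  have h2 := h1.add ((isBigO_refl (fun M : ℕ => √(M:ℝ) ^ 3) atTop).const_mul_left (alp q))
  simpa only [sub_add_cancel] using h2

/-- normalized coefficient -/
noncomputable def f3 (q M : ℕ) : ℝ := (((q:ℝ)+1) * M^2 + M - 2 * av q M) / q
/-- normalized coefficient -/
noncomputable def f4 (q M : ℕ) : ℝ :=
  (((q:ℝ)+1) * M * av q M + (q-3) * f3 q M + 2 * av q M) / (2*q)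
/-- normalized coefficient -/
noncomputable def f5 (q M : ℕ) : ℝ :=
  (((q:ℝ)+1) * M * f3 q M + (2*q-4) * f4 q M + 3 * f3 q M) / (3*q)

lemma qv_eq (q M : ℕ) (hq : 1 ≤ q) (hM : 1 ≤ M) :
    qv q M = (5*q*f5 q M + (6-5*q) * f4 q M + (q-6) * f3 q M + av q M) / (q+1) := by
  obtain ⟨m, rfl⟩ := Nat.exists_eq_add_of_le' hM
  have hq0 : (0:ℝ) < q := by exact_mod_cast hq
  have hc := ee0_pos q m hq
  have hk : 2 ≤ q+1 := by omega
  have h1 := ee_one' hk (m+1)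
  have r1 := ee_rec hk 1 (m+1)
  have r2 := ee_rec hk 2 (m+1)
  have r3 := ee_rec hk 3 (m+1)
  have hQ := QQ_coeff hk (m+1)
  simp only [Nat.reduceAdd] at r1 r2 r3
  have e3 : ee (q+1) 3 (m+1) = f3 q (m+1) * ee (q+1) 0 (m+1) := by
    rw [f3, av]
    rw [h1] at r1
    push_cast at r1 ⊢
    field_simp
    linear_combination -r1
  have e2 : ee (q+1) 2 (m+1) = av q (m+1) * ee (q+1) 0 (m+1) := by
    rw [av]; field_simp
  have e4 : ee (q+1) 4 (m+1) = f4 q (m+1) * ee (q+1) 0 (m+1) := by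
    rw [f4]
    rw [e3, e2] at r2
    push_cast at r2 ⊢
    field_simp
    linear_combination -r2
  have e5 : ee (q+1) 5 (m+1) = f5 q (m+1) * ee (q+1) 0 (m+1) := by
    rw [f5]
    rw [e3, e4] at r3
    push_cast at r3 ⊢
    field_simp
    linear_combination -r3
  rw [e2, e3, e4, e5] at hQ
  rw [qv]
  push_cast at hQ
  field_simp
  linear_combination hQ

lemma f3_bigO (q : ℕ) (hq : 1 ≤ q) :
    (fun M : ℕ => f3 q M - (((q:ℝ)+1)/q) * √(M:ℝ)^4) =O[atTop] (fun M : ℕ => √(M:ℝ) ^ 3) := by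
  have hq0 : (0:ℝ) < q := by exact_mod_cast hq
  have h := ((pow_bigO 2 3 (by norm_num)).const_mul_left (1/(q:ℝ))).add
    ((av_bigO3 q hq).const_mul_left (-2/(q:ℝ)))
  refine h.congr_left fun M => ?_
  have hx : (M:ℝ) = √(M:ℝ)^2 := (Real.sq_sqrt (Nat.cast_nonneg M)).symm
  rw [f3]
  generalize √(M:ℝ) = x at *
  rw [hx]
  field_simp
  ring

lemma f3_bigO4 (q : ℕ) (hq : 1 ≤ q) :
    (fun M : ℕ => f3 q M) =O[atTop] (fun M : ℕ => √(M:ℝ) ^ 4) := by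
  have h1 := (f3_bigO q hq).trans (pow_bigO 3 4 (by norm_num))
  have h2 := h1.add ((isBigO_refl (fun M : ℕ => √(M:ℝ) ^ 4) atTop).const_mul_left (((q:ℝ)+1)/q))
  simpa only [sub_add_cancel] using h2

lemma mul_pow_bigO (i j : ℕ) (f : ℕ → ℝ) (h : f =O[atTop] (fun M : ℕ => √(M:ℝ) ^ j)) :
    (fun M : ℕ => √(M:ℝ)^i * f M) =O[atTop] (fun M : ℕ => √(M:ℝ) ^ (i+j)) := by
  simpa only [pow_add] using (isBigO_refl (fun M : ℕ => √(M:ℝ) ^ i) atTop).mul h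

lemma f4_bigO (q : ℕ) (hq : 1 ≤ q) :
    (fun M : ℕ => f4 q M) =O[atTop] (fun M : ℕ => √(M:ℝ) ^ 5) := by
  have hq0 : (0:ℝ) < q := by exact_mod_cast hq
  have h := ((mul_pow_bigO 2 3 _ (av_bigO3 q hq)).const_mul_left (((q:ℝ)+1)/(2*q))).add
    ((((f3_bigO4 q hq).trans (pow_bigO 4 5 (by norm_num))).const_mul_left (((q:ℝ)-3)/(2*q))).add
    (((av_bigO3 q hq).trans (pow_bigO 3 5 (by norm_num))).const_mul_left (1/(q:ℝ))))
  refine h.congr_left fun M => ?_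
  have hx : √(M:ℝ)^2 = M := Real.sq_sqrt (Nat.cast_nonneg M)
  rw [f4, hx]
  field_simp
  try ring

lemma f5_bigO (q : ℕ) (hq : 1 ≤ q) :
    (fun M : ℕ => f5 q M - (((q:ℝ)+1)^2/(3*q^2)) * √(M:ℝ)^6) =O[atTop]
      (fun M : ℕ => √(M:ℝ) ^ 5) := by
  have hq0 : (0:ℝ) < q := by exact_mod_cast hq
  have h := ((mul_pow_bigO 2 3 _ (f3_bigO q hq)).const_mul_left (((q:ℝ)+1)/(3*q))).add
    (((f4_bigO q hq).const_mul_left ((2*(q:ℝ)-4)/(3*q))).add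
    (((f3_bigO4 q hq).trans (pow_bigO 4 5 (by norm_num))).const_mul_left (1/(q:ℝ))))
  refine h.congr_left fun M => ?_
  have hx : (M:ℝ) = √(M:ℝ)^2 := (Real.sq_sqrt (Nat.cast_nonneg M)).symm
  rw [f5]
  generalize √(M:ℝ) = x at *
  rw [hx]
  field_simp
  ring

lemma qv_bigO (q : ℕ) (hq : 1 ≤ q) :
    (fun M : ℕ => qv q M - (5*((q:ℝ)+1)/(3*q)) * √(M:ℝ)^6) =O[atTop]
      (fun M : ℕ => √(M:ℝ) ^ 5) := by
  have hq0 : (0:ℝ) < q := by exact_mod_cast hq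
  have h := ((f5_bigO q hq).const_mul_left (5*(q:ℝ)/(q+1))).add
    (((f4_bigO q hq).const_mul_left ((6-5*(q:ℝ))/(q+1))).add
    ((((f3_bigO4 q hq).trans (pow_bigO 4 5 (by norm_num))).const_mul_left (((q:ℝ)-6)/(q+1))).add
    (((av_bigO3 q hq).trans (pow_bigO 3 5 (by norm_num))).const_mul_left (1/((q:ℝ)+1)))))
  refine h.congr' ?_ EventuallyEq.rfl
  filter_upwards [eventually_ge_atTop 1] with M hM
  rw [qv_eq q M hq hM]
  field_simp
  ring

lemma var_bigO (q : ℕ) (hq : 1 ≤ q) :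
    (fun M : ℕ => (qv q M - av q M ^ 2) - (((q:ℝ)+1)/(2*q)) * (10/3 - Real.pi) * √(M:ℝ)^6)
      =O[atTop] (fun M : ℕ => √(M:ℝ) ^ 5) := by
  have hq0 : (0:ℝ) < q := by exact_mod_cast hq
  have ha := av_bigO q hq
  have h2 := (ha.mul ha)
  have h2' : (fun M : ℕ => (av q M - alp q * √(M:ℝ) ^ 3) * (av q M - alp q * √(M:ℝ) ^ 3))
      =O[atTop] (fun M : ℕ => √(M:ℝ) ^ 5) := by
    simp only [← pow_add] at h2
    exact h2.trans (pow_bigO 4 5 (by norm_num))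
  have h := (qv_bigO q hq).sub (h2'.add ((mul_pow_bigO 3 2 _ ha).const_mul_left (2 * alp q)))
  refine h.congr_left fun M => ?_
  have hal := alp_sq q hq
  have : (((q:ℝ)+1)/(2*q)) * (10/3 - Real.pi) = 5*((q:ℝ)+1)/(3*q) - alp q ^ 2 := by
    rw [hal]; field_simp; ring
  rw [this]
  ring

lemma card_sz (q m : ℕ) : ((sz (q+1) (m+1)).card : ℝ) = ee (q+1) 0 (m+1) := by
  rw [ee_zero, TT, coeff_gf]; simp

lemma kRegSet_eq (k M : ℕ) : kRegSet k (M+1) = {t : KTree k | t.numNodes = M} := by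
  simp [kRegSet]

lemma finsum_eq (k M : ℕ) (f : KTree k → ℝ) :
    ∑ᶠ t ∈ kRegSet k (M+1), f t = ∑ t ∈ sz k M, f t := by
  rw [kRegSet_eq, finsum_mem_eq_finite_toFinset_sum f (finite_eq_s18 k M)]; rfl

lemma card_eq (k M : ℕ) : Nat.card (kRegSet k (M+1)) = (sz k M).card := by
  rw [kRegSet_eq, Nat.card_coe_set_eq, Set.ncard_eq_toFinset_card _ (finite_eq_s18 k M)]; rfl

lemma var_eq (q M : ℕ) (hq : 1 ≤ q) (hM : 1 ≤ M) :
    varIPL (q+1) (M+1) = qv q M - av q M ^ 2 := by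
  obtain ⟨m, rfl⟩ := Nat.exists_eq_add_of_le' hM
  have hc := ee0_pos q m hq
  have hE : expIPL (q+1) (m+1+1) = av q (m+1) := by
    rw [expIPL, finsum_eq, card_eq, card_sz, av, ← GG_coeff, GG, coeff_gf]; rfl
  have h1 : ∑ t ∈ sz (q+1) (m+1), R t = av q (m+1) * ee (q+1) 0 (m+1) := by
    rw [av, ← GG_coeff, GG, coeff_gf]; field_simp
  have h2 : ∑ t ∈ sz (q+1) (m+1), R t ^ 2 = qv q (m+1) * ee (q+1) 0 (m+1) := by
    rw [qv, QQ, coeff_gf]; field_simp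
  rw [varIPL, finsum_eq, card_eq, card_sz, hE, div_eq_iff hc.ne']
  have : ∀ t : KTree (q+1), ((iplReg t : ℝ) - av q (m+1)) ^ 2
      = R t ^ 2 - 2 * av q (m+1) * R t + av q (m+1) ^ 2 := by
    intro t; rw [R]; ring
  simp only [this]
  rw [Finset.sum_add_distrib, Finset.sum_sub_distrib, ← Finset.mul_sum, h1, h2, Finset.sum_const,
    nsmul_eq_mul, card_sz]
  ring

lemma var_zero (k : ℕ) : varIPL k 1 = 0 := by
  have hE : expIPL k (0+1) = 0 := by
    rw [expIPL, finsum_eq, sz_zero]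
    simp [iplReg, ipl, numNodes]
  have : varIPL k (0+1) = 0 := by
    rw [varIPL, finsum_eq, sz_zero, hE]
    simp [iplReg, ipl, numNodes]
  exact this

end KTree

/-- For a uniformly random `k`-regular tree with `n`
interior nodes,
`Var[IPL(T)] = (k/(2(k-1)))(10/3 - π) n³ (1 + O(n^{-1/2}))`. -/
theorem varIPL_asymptotics (k : ℕ) (hk : 2 ≤ k) :
    ∃ M : ℝ, 0 < M ∧ ∀ n : ℕ, 1 ≤ n →
      |varIPL k n /
          (((k : ℝ) / (2 * ((k : ℝ) - 1))) * (10 / 3 - Real.pi) * (n : ℝ) ^ 3) - 1| ≤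
        M * (n : ℝ) ^ (-(1 : ℝ) / 2) := by
  obtain ⟨q, hq, rfl⟩ : ∃ p, 1 ≤ p ∧ k = p + 1 := ⟨k-1, by omega, by omega⟩
  have hq0 : (0:ℝ) < q := by exact_mod_cast hq
  obtain ⟨C, hC, hb⟩ := Asymptotics.bound_of_isBigO_nat_atTop (KTree.var_bigO q hq)
  have hpi : 0 < 10/3 - Real.pi := by linarith [Real.pi_lt_d2]
  have hA0 : 0 < ((q:ℝ)+1)/(2*q) * (10/3 - Real.pi) := by positivity
  have hAe : (((q+1:ℕ):ℝ) / (2 * (((q+1:ℕ):ℝ) - 1))) * (10 / 3 - Real.pi)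
      = ((q:ℝ)+1)/(2*q) * (10/3 - Real.pi) := by push_cast; rw [add_sub_cancel_right]
  simp only [hAe]
  set A := ((q:ℝ)+1)/(2*q) * (10/3 - Real.pi) with hA
  refine ⟨1 + (C + 3*A)/A, by positivity, fun n hn => ?_⟩
  obtain ⟨M, rfl⟩ := Nat.exists_eq_add_of_le' hn
  rcases Nat.eq_zero_or_pos M with h0 | hM
  · subst h0
    rw [zero_add, KTree.var_zero]
    have : 0 ≤ (C + 3*A)/A := by positivity
    simp
    exact this
  · have hMr : (1:ℝ) ≤ M := by exact_mod_cast hM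
    have hx0 : 0 < √(M:ℝ) := Real.sqrt_pos.mpr (by linarith)
    have h := hb (x := M) (by positivity)
    rw [← KTree.var_eq q M hq hM, Real.norm_eq_abs, Real.norm_of_nonneg (by positivity)] at h
    set y := √((M+1:ℕ):ℝ) with hy
    have hy2 : y^2 = M+1 := by rw [hy, Real.sq_sqrt (by positivity)]; push_cast; ring
    have hy0 : 0 < y := Real.sqrt_pos.mpr (by positivity)
    have hxy : √(M:ℝ) ≤ y := Real.sqrt_le_sqrt (by push_cast; linarith)
    have hy1 : 1 ≤ y := by nlinarith
    have hx6 : √(M:ℝ)^6 = (M:ℝ)^3 := by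
      rw [show (6:ℕ) = 2*3 by norm_num, pow_mul, Real.sq_sqrt (by linarith)]
    have hn3 : ((M+1:ℕ):ℝ)^3 = y^6 := by push_cast; rw [← hy2]; ring
    have hrp : ((M+1:ℕ):ℝ) ^ (-(1:ℝ)/2) = 1 / y := by
      rw [show -(1:ℝ)/2 = -(1/2) by ring, Real.rpow_neg (by positivity), ← Real.sqrt_eq_rpow, ← hy,
        one_div]
    rw [hrp, hn3]
    have hd : |varIPL (q+1) (M+1) - A * y^6| ≤ (C + 3*A) * y^5 := by
      have e : varIPL (q+1) (M+1) - A * y^6 =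
        (varIPL (q+1) (M+1) - A * √(M:ℝ)^6) + (- (A * (y^6 - √(M:ℝ)^6))) := by ring
      have hdiff0 : 0 ≤ y^6 - √(M:ℝ)^6 := by
        have := pow_le_pow_left₀ hx0.le hxy 6
        linarith
      have hdiff : y^6 - √(M:ℝ)^6 ≤ 3 * y^5 := by
        have : y^6 - √(M:ℝ)^6 ≤ 3 * y^4 := by
          rw [hx6, show y^6 = (y^2)^3 by ring, show y^4 = (y^2)^2 by ring, hy2]
          nlinarith
        have : y^4 ≤ y^5 := pow_le_pow_right₀ hy1 (by norm_num)
        linarith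
      rw [e]
      refine (abs_add_le _ _).trans ?_
      rw [abs_neg, abs_of_nonneg (mul_nonneg hA0.le hdiff0)]
      have t1 : C * √(M:ℝ)^5 ≤ C * y^5 := by gcongr
      have t2 := mul_le_mul_of_nonneg_left hdiff hA0.le
      linarith
    have e : varIPL (q+1) (M+1) / (A * y^6) - 1 = (varIPL (q+1) (M+1) - A * y^6) / (A * y^6) := by
      field_simp
    rw [e, abs_div, abs_of_pos (by positivity : 0 < A * y^6), div_le_iff₀ (by positivity)]
    refine hd.trans ?_
    have e2 : (1 + (C + 3*A)/A) * (1/y) * (A * y^6) = A * y^5 + (C + 3*A) * y^5 := by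
      field_simp
    rw [e2]
    have : 0 ≤ A * y^5 := by positivity
    linarith
end
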